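/- arXiv:1802.03218 — 2 statements merged into one kernel-verified Lean document; each statement's English description precedes it below -/
import Mathlib

section
/- Let 0 < λ ≤ Λ and N ≥ 2 an integer with Ñ := (λ/Λ)(N−1) + 1 > 2. Assume: (a) there exists a normalized fast-decaying entire solution U at exponent p⋆ > 1, with inflection radius R₀ > 0; (b) the Dirichlet problem in the unit ball with exponent p⋆ has no positive radial solution. Let εₙ → 0⁺ with pₙ := p⋆ − εₙ > 1, let uₙ be positive radial solutions of the Dirichlet problem with exponent pₙ having a unique inflection radius r₀(n) ∈ (0,1), and set Mₙ := uₙ(0). Then, as n → ∞: (i) r₀(n)^{2/(pₙ−1)}·Mₙ → R₀^{2/(p⋆−1)} (equivalently, Mₙ^{(pₙ−1)/2}·r₀(n) → R₀); (ii) uₙ(r₀(n))/Mₙ → U(R₀); (iii) r₀(n)^{2/(pₙ−1)}·uₙ(r₀(n)) → R₀^{2/(p⋆−1)}·U(R₀). -/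
open Real Filter Set

/-- The radial Pucci maximal operator `M⁺_{λ,Λ}` applied to a radial C² function `u`
of the radial variable `r`. -/
noncomputable def radialPucci (lam Lam : ℝ) (N : ℕ) (u : ℝ → ℝ) (r : ℝ) : ℝ :=
  Lam * max (deriv (deriv u) r) 0 + lam * min (deriv (deriv u) r) 0 +
    ((N : ℝ) - 1) * (Lam * max (deriv u r / r) 0 + lam * min (deriv u r / r) 0)

/-- A positive radial solution of the Dirichlet problem `-M⁺[u] = u^q` in the unit ball. -/
def IsDirichletSol (lam Lam : ℝ) (N : ℕ) (q : ℝ) (u : ℝ → ℝ) : Prop :=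
  ContDiffOn ℝ 2 u (Set.Icc 0 1) ∧
    (∀ r ∈ Set.Ico (0 : ℝ) 1, 0 < u r) ∧
    u 1 = 0 ∧ deriv u 0 = 0 ∧
    (∀ r ∈ Set.Icc (0 : ℝ) 1, deriv u r ≤ 0) ∧
    (∀ r ∈ Set.Ioo (0 : ℝ) 1, -radialPucci lam Lam N u r = u r ^ q)

/-- `r0 ∈ (0,1)` is the (unique) inflection radius of `u` in the unit ball. -/
def InflectionAt (u : ℝ → ℝ) (r0 : ℝ) : Prop :=
  r0 ∈ Set.Ioo (0 : ℝ) 1 ∧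
    (∀ r ∈ Set.Ico (0 : ℝ) r0, deriv (deriv u) r < 0) ∧
    deriv (deriv u) r0 = 0 ∧
    (∀ r ∈ Set.Ioo r0 (1 : ℝ), 0 < deriv (deriv u) r)

/-- A normalized fast-decaying entire radial solution of `-M⁺[U] = U^{p⋆}` in `ℝ^N`,
with fast-decay constant `c1` and inflection radius `R0`. -/
def IsEntireSol (lam Lam : ℝ) (N : ℕ) (Ntil pstar c1 R0 : ℝ) (U : ℝ → ℝ) : Prop :=
  ContDiffOn ℝ 2 U (Set.Ici 0) ∧
    (∀ r : ℝ, 0 ≤ r → 0 < U r) ∧ U 0 = 1 ∧ deriv U 0 = 0 ∧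
    (∀ r : ℝ, 0 < r → deriv U r < 0) ∧
    (∀ r : ℝ, 0 < r → -radialPucci lam Lam N U r = U r ^ pstar) ∧
    0 < R0 ∧
    (∀ r ∈ Set.Ico (0 : ℝ) R0, deriv (deriv U) r < 0) ∧
    deriv (deriv U) R0 = 0 ∧
    (∀ r : ℝ, R0 < r → 0 < deriv (deriv U) r) ∧
    0 < c1 ∧
    Filter.Tendsto (fun r : ℝ => r ^ (Ntil - 2) * U r) Filter.atTop (nhds c1) ∧
    Filter.Tendsto (fun r : ℝ => r ^ (Ntil - 1) * deriv U r) Filter.atTop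
      (nhds (-(Ntil - 2) * c1))

/-- `v`, with first and second derivatives `v1` and `v2` on `(0, L)`, is a positive nonincreasing
solution on `[0, L)`, normalized by `v 0 = 1`, of the radial equation `-M⁺[v] = v ^ q`, where
`k = N - 1`. -/
structure IsNormalizedIVPSol (lam Lam k q L : ℝ) (v v1 v2 : ℝ → ℝ) : Prop where
  cont : ContinuousOn v (Set.Icc 0 L)
  cont1 : ContinuousOn v1 (Set.Ico 0 L)
  zero : v 0 = 1
  zero1 : v1 0 = 0
  deriv0 : ∀ r ∈ Set.Ioo 0 L, HasDerivAt v (v1 r) r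
  deriv1 : ∀ r ∈ Set.Ioo 0 L, HasDerivAt v1 (v2 r) r
  nonpos : ∀ r ∈ Set.Ioo 0 L, v1 r ≤ 0
  pos : ∀ r ∈ Set.Ioo 0 L, 0 < v r
  eqn : ∀ r ∈ Set.Ioo 0 L,
    Lam * max (v2 r) 0 + lam * min (v2 r) 0 = -(k * lam * (v1 r / r)) - v r ^ q

namespace IsNormalizedIVPSol

variable {lam Lam k p q L : ℝ} {v v1 v2 w w1 w2 : ℝ → ℝ}

lemma restrict (h : IsNormalizedIVPSol lam Lam k q L v v1 v2) {l : ℝ} (hl : l ≤ L) :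
    IsNormalizedIVPSol lam Lam k q l v v1 v2 where
  cont := h.cont.mono (Icc_subset_Icc_right hl)
  cont1 := h.cont1.mono (Ico_subset_Ico_right hl)
  zero := h.zero
  zero1 := h.zero1
  deriv0 r hr := h.deriv0 r (Ioo_subset_Ioo_right hl hr)
  deriv1 r hr := h.deriv1 r (Ioo_subset_Ioo_right hl hr)
  nonpos r hr := h.nonpos r (Ioo_subset_Ioo_right hl hr)
  pos r hr := h.pos r (Ioo_subset_Ioo_right hl hr)
  eqn r hr := h.eqn r (Ioo_subset_Ioo_right hl hr)

lemma antitoneOn (h : IsNormalizedIVPSol lam Lam k q L v v1 v2) :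
    AntitoneOn v (Set.Icc 0 L) := by
  apply antitoneOn_of_deriv_nonpos (convex_Icc 0 L) h.cont
  · rw [interior_Icc]
    exact fun r hr => (h.deriv0 r hr).differentiableAt.differentiableWithinAt
  · rw [interior_Icc]
    intro r hr
    rw [(h.deriv0 r hr).deriv]
    exact h.nonpos r hr

lemma le_one (h : IsNormalizedIVPSol lam Lam k q L v v1 v2) {r : ℝ} (hr : r ∈ Set.Icc 0 L) :
    v r ≤ 1 := by
  rw [← h.zero]
  exact h.antitoneOn ⟨le_rfl, hr.1.trans hr.2⟩ hr hr.1

end IsNormalizedIVPSol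

lemma mul_sub_le_pucci_sub {lam Lam x y : ℝ} (hlL : lam ≤ Lam) (hxy : y ≤ x) :
    lam * (x - y) ≤ (Lam * max x 0 + lam * min x 0) - (Lam * max y 0 + lam * min y 0) := by
  rcases le_total x 0 with hx | hx <;> rcases le_total y 0 with hy | hy <;>
    simp only [hx, hy, max_eq_left, max_eq_right, min_eq_left, min_eq_right] <;> nlinarith

lemma abs_rpow_sub_rpow_le_exponent_sub {t p q : ℝ} (ht : 0 < t) (ht1 : t ≤ 1) (hq : 1 < q)
    (hqp : q ≤ p) : |t ^ q - t ^ p| ≤ p - q := by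
  have hle : t ^ p ≤ t ^ q := rpow_le_rpow_of_exponent_ge ht ht1 hqp
  rw [abs_of_nonneg (by linarith)]
  have hfac : t ^ p = t ^ q * t ^ (p - q) := by rw [← rpow_add ht]; ring_nf
  have hq1 : t ^ q ≤ t := by
    simpa using rpow_le_rpow_of_exponent_ge ht ht1 hq.le
  have h1 : 1 + (p - q) * log t ≤ t ^ (p - q) := by
    rw [rpow_def_of_pos ht]
    linarith [add_one_le_exp (log t * (p - q))]
  have h2 : -log t ≤ t⁻¹ - 1 := by
    rw [← log_inv]; exact log_le_sub_one_of_pos (inv_pos.2 ht)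
  have h3 : t * (-log t) ≤ 1 := by
    have := mul_le_mul_of_nonneg_left h2 ht.le
    rw [mul_sub, mul_inv_cancel₀ ht.ne'] at this
    linarith
  have h4 : t ^ (p - q) ≤ 1 := rpow_le_one ht.le ht1 (by linarith)
  calc t ^ q - t ^ p = t ^ q * (1 - t ^ (p - q)) := by rw [hfac]; ring
    _ ≤ t * (1 - t ^ (p - q)) := by gcongr
    _ ≤ t * ((p - q) * (-log t)) := by gcongr; linarith
    _ = (p - q) * (t * (-log t)) := by ring
    _ ≤ (p - q) * 1 := by gcongr
    _ = p - q := mul_one _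

lemma abs_rpow_sub_rpow_le_mul_abs_sub {x y p : ℝ} (hx : 0 < x) (hx1 : x ≤ 1) (hy : 0 < y)
    (hy1 : y ≤ 1) (hp : 1 < p) : |x ^ p - y ^ p| ≤ p * |x - y| := by
  have := (convex_Ioc (0 : ℝ) 1).norm_image_sub_le_of_norm_hasDerivWithin_le
    (f := fun t => t ^ p) (f' := fun t => p * t ^ (p - 1)) (C := p)
    (fun t ht => (hasDerivAt_rpow_const (Or.inl ht.1.ne')).hasDerivWithinAt)
    (fun t ht => by
      rw [norm_of_nonneg (mul_nonneg (by linarith) (rpow_nonneg ht.1.le _))]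
      have : t ^ (p - 1) ≤ 1 := rpow_le_one ht.1.le ht.2 (by linarith)
      nlinarith) ⟨hy, hy1⟩ ⟨hx, hx1⟩
  simpa [Real.norm_eq_abs] using this

/-- The growth rate in the continuous dependence estimate. -/
noncomputable def ivpRate (lam p : ℝ) : ℝ := 1 + (1 + p) / lam

/-- The constant in the continuous dependence estimate on an interval of length `T`. -/
noncomputable def ivpConst (lam p T : ℝ) : ℝ :=
  rexp (ivpRate lam p * T) * (1 / (lam * ivpRate lam p))

lemma ivpRate_pos {lam p : ℝ} (hlam : 0 < lam) (hp : 1 < p) : 0 < ivpRate lam p := by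
  unfold ivpRate; positivity

lemma ivpConst_nonneg {lam p T : ℝ} (hlam : 0 < lam) (hp : 1 < p) : 0 ≤ ivpConst lam p T := by
  have := ivpRate_pos hlam hp
  unfold ivpConst; positivity

namespace IsNormalizedIVPSol

variable {lam Lam k p q L : ℝ} {v v1 v2 w w1 w2 : ℝ → ℝ}

/-- The singular first-order term is dissipative, so only the difference of the right-hand sides
contributes to the growth of the difference of the first derivatives. -/
lemma deriv_sub_mul_le (hlam : 0 < lam) (hlL : lam ≤ Lam) (hk : 0 ≤ k)
    (hv : IsNormalizedIVPSol lam Lam k q L v v1 v2)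
    (hw : IsNormalizedIVPSol lam Lam k p L w w1 w2) {r : ℝ} (hr : r ∈ Set.Ioo 0 L) :
    (v1 r - w1 r) * (v2 r - w2 r) ≤ |v1 r - w1 r| * (|v r ^ q - w r ^ p| / lam) := by
  have ev := hv.eqn r hr
  have ew := hw.eqn r hr
  have hr0 : 0 < r := hr.1
  have key : ∀ a b : ℝ, 0 ≤ a - b → 0 ≤ k * lam * (a / r) - k * lam * (b / r) := by
    intro a b hab
    have : k * lam * (a / r) - k * lam * (b / r) = k * lam * ((a - b) / r) := by ring
    rw [this]; positivity
  have hb1 := le_abs_self (v r ^ q - w r ^ p)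
  have hb2 := neg_abs_le (v r ^ q - w r ^ p)
  rcases le_total 0 (v1 r - w1 r) with h | h
  · rw [abs_of_nonneg h]
    refine mul_le_mul_of_nonneg_left ?_ h
    rcases le_total (v2 r) (w2 r) with h2 | h2
    · have : 0 ≤ |v r ^ q - w r ^ p| / lam := by positivity
      linarith
    · rw [le_div_iff₀ hlam]
      linarith [mul_sub_le_pucci_sub hlL h2, key _ _ h]
  · rw [abs_of_nonpos h, ← neg_mul_neg]
    refine mul_le_mul_of_nonneg_left ?_ (by linarith)
    rcases le_total (w2 r) (v2 r) with h2 | h2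
    · have : 0 ≤ |v r ^ q - w r ^ p| / lam := by positivity
      linarith
    · rw [le_div_iff₀ hlam]
      linarith [mul_sub_le_pucci_sub hlL h2, key (w1 r) (v1 r) (by linarith)]

/-- Continuous dependence of the normalized solution on the exponent. -/
lemma sq_add_sq_le (hlam : 0 < lam) (hlL : lam ≤ Lam) (hk : 0 ≤ k) (hq : 1 < q) (hqp : q ≤ p)
    {T : ℝ} (hLT : L ≤ T) (hv : IsNormalizedIVPSol lam Lam k q L v v1 v2)
    (hw : IsNormalizedIVPSol lam Lam k p L w w1 w2) {r : ℝ} (hr : r ∈ Set.Ico 0 L) :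
    (v r - w r) ^ 2 + (v1 r - w1 r) ^ 2 ≤ (p - q) ^ 2 * ivpConst lam p T := by
  have hp : 1 < p := hq.trans_le hqp
  have hC := ivpRate_pos hlam hp
  set C := ivpRate lam p with hCdef
  set a := (p - q) ^ 2 * (1 / (lam * C)) with ha
  have ha0 : 0 ≤ a := by positivity
  let F : ℝ → ℝ := fun s => rexp (-(C * s)) * ((v s - w s) ^ 2 + (v1 s - w1 s) ^ 2 + a)
  have hF : ∀ s ∈ Set.Ioo 0 L, HasDerivAt F
      (rexp (-(C * s)) * (-C) * ((v s - w s) ^ 2 + (v1 s - w1 s) ^ 2 + a) + rexp (-(C * s)) *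
        (2 * (v s - w s) * (v1 s - w1 s) + 2 * (v1 s - w1 s) * (v2 s - w2 s))) s := by
    intro s hs
    have h1 : HasDerivAt (fun s => rexp (-(C * s))) (rexp (-(C * s)) * (-C)) s := by
      have := ((hasDerivAt_id s).const_mul C).neg.exp
      simpa using this
    have h2 := (((hv.deriv0 s hs).sub (hw.deriv0 s hs)).pow 2).add
      (((hv.deriv1 s hs).sub (hw.deriv1 s hs)).pow 2)
    have h3 := h1.mul (h2.add_const a)
    exact h3.congr_deriv (by simp)
  have hmono : AntitoneOn F (Set.Ico 0 L) := by
    apply antitoneOn_of_deriv_nonpos (convex_Ico 0 L)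
    · have c1 := hv.cont.mono Ico_subset_Icc_self
      have c2 := hw.cont.mono Ico_subset_Icc_self
      have c3 := hv.cont1
      have c4 := hw.cont1
      fun_prop
    · rw [interior_Ico]
      exact fun s hs => (hF s hs).differentiableAt.differentiableWithinAt
    · rw [interior_Ico]
      intro s hs
      rw [(hF s hs).deriv]
      have hd := deriv_sub_mul_le hlam hlL hk hv hw hs
      have hs' := Ioo_subset_Icc_self hs
      have hb : |v s ^ q - w s ^ p| ≤ (p - q) + p * |v s - w s| := by
        refine (abs_sub_le _ (v s ^ p) _).trans (add_le_add ?_ ?_)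
        · exact abs_rpow_sub_rpow_le_exponent_sub (hv.pos s hs) (hv.le_one hs') hq hqp
        · exact abs_rpow_sub_rpow_le_mul_abs_sub (hv.pos s hs) (hv.le_one hs') (hw.pos s hs)
            (hw.le_one hs') hp
      have hx : (v s - w s) ^ 2 = |v s - w s| ^ 2 := (sq_abs _).symm
      have hy : (v1 s - w1 s) ^ 2 = |v1 s - w1 s| ^ 2 := (sq_abs _).symm
      have hxy : (v s - w s) * (v1 s - w1 s) ≤ |v s - w s| * |v1 s - w1 s| := by
        rw [← abs_mul]; exact le_abs_self _
      set x := |v s - w s|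
      set y := |v1 s - w1 s|
      have hy0 : 0 ≤ y := abs_nonneg _
      have hx0 : 0 ≤ x := abs_nonneg _
      have hd2 : (v1 s - w1 s) * (v2 s - w2 s) ≤ y * (((p - q) + p * x) / lam) :=
        hd.trans (by gcongr)
      have hCa : C * a = (p - q) ^ 2 / lam := by
        rw [ha]; field_simp
      have hCe : C = 1 + (1 + p) / lam := rfl
      have hmain : 2 * (x * y) + 2 * (y * (((p - q) + p * x) / lam)) ≤
          C * (x ^ 2 + y ^ 2) + (p - q) ^ 2 / lam := by
        have h1 : 2 * (x * y) ≤ x ^ 2 + y ^ 2 := by nlinarith [sq_nonneg (x - y)]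
        have h2 : 2 * (y * ((p - q) + p * x)) ≤ (1 + p) * (x ^ 2 + y ^ 2) + (p - q) ^ 2 := by
          nlinarith [sq_nonneg (x - y), sq_nonneg (y - (p - q)), sq_nonneg x]
        have h3 : 2 * (y * (((p - q) + p * x) / lam)) ≤
            (1 + p) / lam * (x ^ 2 + y ^ 2) + (p - q) ^ 2 / lam := by
          have := div_le_div_of_nonneg_right h2 hlam.le
          calc _ = 2 * (y * ((p - q) + p * x)) / lam := by ring
            _ ≤ _ := this
            _ = _ := by ring
        rw [hCe]; linarith
      have : rexp (-(C * s)) * (-C) * ((v s - w s) ^ 2 + (v1 s - w1 s) ^ 2 + a) +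
          rexp (-(C * s)) *
          (2 * (v s - w s) * (v1 s - w1 s) + 2 * (v1 s - w1 s) * (v2 s - w2 s)) =
          rexp (-(C * s)) * (2 * ((v s - w s) * (v1 s - w1 s)) +
            2 * ((v1 s - w1 s) * (v2 s - w2 s)) - (C * (x ^ 2 + y ^ 2) + C * a)) := by
        rw [hx, hy]; ring
      rw [this, hCa]
      refine mul_nonpos_of_nonneg_of_nonpos (exp_pos _).le ?_
      linarith
  have h0 := hmono ⟨le_rfl, hr.1.trans_lt hr.2⟩ hr hr.1
  have hF0 : F 0 = a := by simp [F, hv.zero, hw.zero, hv.zero1, hw.zero1]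
  rw [hF0] at h0
  have h1 : (v r - w r) ^ 2 + (v1 r - w1 r) ^ 2 + a ≤ rexp (C * r) * a := by
    have := mul_le_mul_of_nonneg_left h0 (exp_pos (C * r)).le
    rwa [← mul_assoc, ← exp_add, add_neg_cancel, exp_zero, one_mul] at this
  have h2 : rexp (C * r) * a ≤ rexp (C * T) * a := by
    have : r ≤ T := hr.2.le.trans hLT
    gcongr
  have h3 : rexp (C * T) * a = (p - q) ^ 2 * ivpConst lam p T := by
    rw [ivpConst, ha]; ring
  linarith

/-- The value and the first derivative depend on the exponent in a Lipschitz way. -/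
lemma abs_sub_le (hlam : 0 < lam) (hlL : lam ≤ Lam) (hk : 0 ≤ k) (hq : 1 < q) (hqp : q ≤ p)
    {T : ℝ} (hLT : L ≤ T) (hv : IsNormalizedIVPSol lam Lam k q L v v1 v2)
    (hw : IsNormalizedIVPSol lam Lam k p L w w1 w2) {r : ℝ} (hr : r ∈ Set.Ico 0 L) :
    |v r - w r| ≤ (p - q) * √(ivpConst lam p T) ∧
      |v1 r - w1 r| ≤ (p - q) * √(ivpConst lam p T) := by
  have h := sq_add_sq_le hlam hlL hk hq hqp hLT hv hw hr
  have hK := ivpConst_nonneg (T := T) hlam (hq.trans_le hqp)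
  have hnn : 0 ≤ (p - q) * √(ivpConst lam p T) := mul_nonneg (by linarith) (sqrt_nonneg _)
  have hsq : ((p - q) * √(ivpConst lam p T)) ^ 2 = (p - q) ^ 2 * ivpConst lam p T := by
    rw [mul_pow, sq_sqrt hK]
  constructor
  · exact abs_le_of_sq_le_sq (by nlinarith [sq_nonneg (v1 r - w1 r)]) hnn
  · exact abs_le_of_sq_le_sq (by nlinarith [sq_nonneg (v r - w r)]) hnn

lemma second_deriv_neg_iff (hlam : 0 < lam) (hlL : lam ≤ Lam)
    (hv : IsNormalizedIVPSol lam Lam k q L v v1 v2) {r : ℝ} (hr : r ∈ Set.Ioo 0 L) :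
    v2 r < 0 ↔ -(k * lam * (v1 r / r)) - v r ^ q < 0 := by
  rw [← hv.eqn r hr]
  rcases le_total (v2 r) 0 with h | h
  · simp [h, mul_neg_iff, hlam]
  · have : 0 < Lam := hlam.trans_le hlL
    simp only [h, max_eq_left, min_eq_right, mul_zero, add_zero]
    constructor <;> intro h' <;> nlinarith

lemma second_deriv_pos_iff (hlam : 0 < lam) (hlL : lam ≤ Lam)
    (hv : IsNormalizedIVPSol lam Lam k q L v v1 v2) {r : ℝ} (hr : r ∈ Set.Ioo 0 L) :
    0 < v2 r ↔ 0 < -(k * lam * (v1 r / r)) - v r ^ q := by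
  rw [← hv.eqn r hr]
  have : 0 < Lam := hlam.trans_le hlL
  rcases le_total (v2 r) 0 with h | h
  · simp only [h, max_eq_right, min_eq_left, mul_zero, zero_add]
    constructor <;> intro h' <;> nlinarith
  · simp [h, this]

end IsNormalizedIVPSol

section Sequences

variable {lam Lam k p : ℝ} {w w1 w2 : ℝ → ℝ} {ε : ℕ → ℝ} {v v1 v2 : ℕ → ℝ → ℝ} {L : ℕ → ℝ}

/-- If the limit solution is entire and positive, the first zeros tend to infinity. -/
lemma eventually_lt_zero_radius (hlam : 0 < lam) (hlL : lam ≤ Lam) (hk : 0 ≤ k)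
    (hε : ∀ n, 0 < ε n) (hε0 : Tendsto ε atTop (nhds 0)) (hpn : ∀ n, 1 < p - ε n)
    (hw : ∀ T, IsNormalizedIVPSol lam Lam k p T w w1 w2) (hL : ∀ n, 0 < L n)
    (hv : ∀ n, IsNormalizedIVPSol lam Lam k (p - ε n) (L n) (v n) (v1 n) (v2 n))
    (hvL : ∀ n, v n (L n) = 0) {T : ℝ} (hT : 0 < T) : ∀ᶠ n in atTop, T < L n := by
  have hwT : 0 < w T := (hw (T + 1)).pos T ⟨hT, by linarith⟩
  have hlim : Tendsto (fun n => ε n * √(ivpConst lam p T)) atTop (nhds 0) := by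
    simpa using hε0.mul_const (√(ivpConst lam p T))
  filter_upwards [hlim.eventually_lt_const hwT] with n hn
  by_contra! hle
  have hclose : ∀ r ∈ Set.Ico 0 (L n), |v n r - w r| ≤ ε n * √(ivpConst lam p T) := by
    intro r hr
    have := (IsNormalizedIVPSol.abs_sub_le hlam hlL hk (hpn n) (by linarith [hε n]) hle (hv n)
      (hw (L n)) hr).1
    simpa using this
  have hcont : ContinuousOn (fun r => |v n r - w r|) (Set.Icc 0 (L n)) :=
    ((hv n).cont.sub (hw (L n)).cont).abs
  have hend : |v n (L n) - w (L n)| ≤ ε n * √(ivpConst lam p T) := by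
    have hcl : closure (Set.Ico 0 (L n)) = Set.Icc 0 (L n) := closure_Ico (hL n).ne
    rw [← hcl] at hcont
    refine le_on_closure (f := fun r => |v n r - w r|) hclose hcont continuousOn_const ?_
    rw [hcl]
    exact ⟨(hL n).le, le_rfl⟩
  have hmono : w T ≤ w (L n) := (hw T).antitoneOn ⟨(hL n).le, hle⟩ ⟨hT.le, le_rfl⟩ hle
  rw [hvL, zero_sub, abs_neg, abs_of_nonneg (hwT.le.trans hmono)] at hend
  linarith

/-- Pointwise convergence of the solutions and of their first derivatives. -/
lemma tendsto_value_and_deriv (hlam : 0 < lam) (hlL : lam ≤ Lam) (hk : 0 ≤ k)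
    (hε : ∀ n, 0 < ε n) (hε0 : Tendsto ε atTop (nhds 0)) (hpn : ∀ n, 1 < p - ε n)
    (hw : ∀ T, IsNormalizedIVPSol lam Lam k p T w w1 w2) (hL : ∀ n, 0 < L n)
    (hv : ∀ n, IsNormalizedIVPSol lam Lam k (p - ε n) (L n) (v n) (v1 n) (v2 n))
    (hvL : ∀ n, v n (L n) = 0) {r : ℝ} (hr : 0 < r) :
    Tendsto (fun n => v n r) atTop (nhds (w r)) ∧
      Tendsto (fun n => v1 n r) atTop (nhds (w1 r)) := by
  have hlim : Tendsto (fun n => ε n * √(ivpConst lam p (r + 1))) atTop (nhds 0) := by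
    simpa using hε0.mul_const (√(ivpConst lam p (r + 1)))
  have hev : ∀ᶠ n in atTop, |v n r - w r| ≤ ε n * √(ivpConst lam p (r + 1)) ∧
      |v1 n r - w1 r| ≤ ε n * √(ivpConst lam p (r + 1)) := by
    filter_upwards [eventually_lt_zero_radius hlam hlL hk hε hε0 hpn hw hL hv hvL
      (T := r + 1) (by linarith)] with n hn
    simpa using IsNormalizedIVPSol.abs_sub_le hlam hlL hk (hpn n) (by linarith [hε n]) le_rfl
      ((hv n).restrict hn.le) (hw (r + 1)) (r := r) ⟨hr.le, by linarith⟩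
  constructor
  · rw [tendsto_iff_norm_sub_tendsto_zero]
    exact squeeze_zero' (Eventually.of_forall fun n => norm_nonneg _) (hev.mono fun n h => h.1)
      hlim
  · rw [tendsto_iff_norm_sub_tendsto_zero]
    exact squeeze_zero' (Eventually.of_forall fun n => norm_nonneg _) (hev.mono fun n h => h.2)
      hlim

/-- The inflection radii converge, and so do the values there. -/
lemma tendsto_inflection (hlam : 0 < lam) (hlL : lam ≤ Lam) (hk : 0 ≤ k)
    (hε : ∀ n, 0 < ε n) (hε0 : Tendsto ε atTop (nhds 0)) (hpn : ∀ n, 1 < p - ε n)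
    (hw : ∀ T, IsNormalizedIVPSol lam Lam k p T w w1 w2) (hL : ∀ n, 0 < L n)
    (hv : ∀ n, IsNormalizedIVPSol lam Lam k (p - ε n) (L n) (v n) (v1 n) (v2 n))
    (hvL : ∀ n, v n (L n) = 0) {ρ : ℕ → ℝ} {R : ℝ} (hR : 0 < R)
    (hw_neg : ∀ r ∈ Set.Ioo 0 R, w2 r < 0) (hw_pos : ∀ r, R < r → 0 < w2 r)
    (hρ : ∀ n, 0 < ρ n)
    (hv_neg : ∀ n, ∀ r ∈ Set.Ioo 0 (ρ n), v2 n r < 0)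
    (hv_pos : ∀ n, ∀ r ∈ Set.Ioo (ρ n) (L n), 0 < v2 n r) :
    Tendsto ρ atTop (nhds R) ∧ Tendsto (fun n => v n (ρ n)) atTop (nhds (w R)) := by
  have hlarge : ∀ T : ℝ, 0 < T → ∀ᶠ n in atTop, T < L n := fun T hT =>
    eventually_lt_zero_radius hlam hlL hk hε hε0 hpn hw hL hv hvL hT
  have hsrc : ∀ r : ℝ, 0 < r → Tendsto (fun n => -(k * lam * (v1 n r / r)) - v n r ^ (p - ε n))
      atTop (nhds (-(k * lam * (w1 r / r)) - w r ^ p)) := by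
    intro r hr
    obtain ⟨h0, h1⟩ := tendsto_value_and_deriv hlam hlL hk hε hε0 hpn hw hL hv hvL hr
    have hp : Tendsto (fun n => p - ε n) atTop (nhds p) := by
      simpa using tendsto_const_nhds.sub hε0
    have hwr : 0 < w r := (hw (r + 1)).pos r ⟨hr, by linarith⟩
    exact (((h1.div_const r).const_mul (k * lam)).neg).sub (h0.rpow hp (Or.inl hwr.ne'))
  have hlow : ∀ r ∈ Set.Ioo 0 R, ∀ᶠ n in atTop, r ≤ ρ n := by
    intro r hr
    have h2 := hw_neg r hr
    rw [(hw (r + 1)).second_deriv_neg_iff hlam hlL ⟨hr.1, by linarith⟩] at h2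
    filter_upwards [(hsrc r hr.1).eventually_lt_const h2, hlarge r hr.1] with n hn hrL
    rw [← (hv n).second_deriv_neg_iff hlam hlL ⟨hr.1, hrL⟩] at hn
    by_contra! hlt
    exact lt_asymm hn (hv_pos n r ⟨hlt, hrL⟩)
  have hupp : ∀ r, R < r → ∀ᶠ n in atTop, ρ n ≤ r := by
    intro r hr
    have hr0 : 0 < r := hR.trans hr
    have h2 := hw_pos r hr
    rw [(hw (r + 1)).second_deriv_pos_iff hlam hlL ⟨hr0, by linarith⟩] at h2
    filter_upwards [(hsrc r hr0).eventually_const_lt h2, hlarge r hr0] with n hn hrL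
    rw [← (hv n).second_deriv_pos_iff hlam hlL ⟨hr0, hrL⟩] at hn
    by_contra! hlt
    exact lt_asymm hn (hv_neg n r ⟨hr0, hlt⟩)
  have hlim : Tendsto ρ atTop (nhds R) := by
    refine tendsto_order.2 ⟨fun a ha => ?_, fun a ha => ?_⟩
    · obtain ⟨b, hb, hbR⟩ := exists_between (max_lt ha hR)
      filter_upwards [hlow b ⟨(le_max_right a 0).trans_lt hb, hbR⟩] with n hn
      exact ((le_max_left a 0).trans_lt hb).trans_le hn
    · obtain ⟨b, hRb, hb⟩ := exists_between ha
      filter_upwards [hupp b hRb] with n hn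
      exact hn.trans_lt hb
  refine ⟨hlim, ?_⟩
  have hwc : ContinuousAt w R :=
    ((hw (R + 1)).deriv0 R ⟨hR, by linarith⟩).continuousAt
  have hwρ : Tendsto (fun n => w (ρ n)) atTop (nhds (w R)) := hwc.tendsto.comp hlim
  have hdiff : Tendsto (fun n => v n (ρ n) - w (ρ n)) atTop (nhds 0) := by
    have hK : Tendsto (fun n => ε n * √(ivpConst lam p (R + 2))) atTop (nhds 0) := by
      simpa using hε0.mul_const (√(ivpConst lam p (R + 2)))
    refine squeeze_zero_norm' ?_ hK
    filter_upwards [hlarge (R + 2) (by linarith), hupp (R + 1) (by linarith)] with n hn hρn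
    have := (IsNormalizedIVPSol.abs_sub_le hlam hlL hk (hpn n) (by linarith [hε n]) le_rfl
      ((hv n).restrict hn.le) (hw (R + 2)) (r := ρ n) ⟨(hρ n).le, by linarith⟩).1
    simpa using this
  simpa using hdiff.add hwρ

end Sequences

lemma hasDerivAt_deriv_of_contDiffOn {f : ℝ → ℝ} {s : Set ℝ} (hf : ContDiffOn ℝ 2 f s) {r : ℝ}
    (hr : s ∈ nhds r) :
    HasDerivAt f (deriv f r) r ∧ HasDerivAt (deriv f) (deriv (deriv f) r) r := by
  have h := hf.contDiffAt hr
  refine ⟨(h.differentiableAt (by norm_num)).hasDerivAt, ?_⟩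
  have h1 : ContDiffAt ℝ 1 (deriv f) r := h.derivWithin (m := 1) (by norm_num)
  exact (h1.differentiableAt (by norm_num)).hasDerivAt

lemma radialPucci_of_deriv_nonpos {lam Lam : ℝ} {N : ℕ} {u : ℝ → ℝ} {r : ℝ} (hr : 0 < r)
    (hu : deriv u r ≤ 0) :
    radialPucci lam Lam N u r = Lam * max (deriv (deriv u) r) 0 +
      lam * min (deriv (deriv u) r) 0 + ((N : ℝ) - 1) * lam * (deriv u r / r) := by
  have h : deriv u r / r ≤ 0 := div_nonpos_of_nonpos_of_nonneg hu hr.le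
  rw [radialPucci, max_eq_right h, min_eq_left h]
  ring

lemma IsEntireSol.isNormalizedIVPSol {lam Lam Ntil p c1 R0 : ℝ} {N : ℕ} {U : ℝ → ℝ}
    (hU : IsEntireSol lam Lam N Ntil p c1 R0 U) (T : ℝ) :
    IsNormalizedIVPSol lam Lam ((N : ℝ) - 1) p T U (deriv U) (deriv (deriv U)) := by
  obtain ⟨hC, hpos, h0, h0', hneg, heq, hR0, hinfl, -⟩ := hU
  have hd : ∀ r : ℝ, 0 < r → _ := fun r hr => hasDerivAt_deriv_of_contDiffOn hC (Ici_mem_nhds hr)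
  refine ⟨hC.continuousOn.mono Icc_subset_Ici_self, ?_, h0, h0', fun r hr => (hd r hr.1).1,
    fun r hr => (hd r hr.1).2, fun r hr => (hneg r hr.1).le, fun r hr => hpos r hr.1.le, ?_⟩
  · intro r hr
    refine ContinuousAt.continuousWithinAt ?_
    rcases hr.1.eq_or_lt with rfl | hr'
    · exact (differentiableAt_of_deriv_ne_zero
        (hinfl 0 ⟨le_rfl, hR0⟩).ne).continuousAt
    · exact (hd r hr').2.continuousAt
  · intro r hr
    have := heq r hr.1
    rw [radialPucci_of_deriv_nonpos hr.1 (hneg r hr.1).le] at this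
    linarith

/-- The scaling `s ↦ u (s / β) / M` with `M = u 0`, `β = M ^ ((q - 1) / 2)` turns a solution of the
Dirichlet problem into a normalized one. -/
lemma IsDirichletSol.isNormalizedIVPSol {lam Lam q r0 β : ℝ} {N : ℕ} {u : ℝ → ℝ}
    (hu : IsDirichletSol lam Lam N q u) (hr0 : InflectionAt u r0)
    (hβ : 0 < β) (hβM : β ^ 2 * u 0 = u 0 ^ q) :
    IsNormalizedIVPSol lam Lam ((N : ℝ) - 1) q β (fun s => u (s / β) / u 0)
      (fun s => deriv u (s / β) / (β * u 0))
      (fun s => deriv (deriv u) (s / β) / (β ^ 2 * u 0)) := by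
  obtain ⟨hC, hpos, -, h0', hneg, heq⟩ := hu
  have hM : 0 < u 0 := hpos 0 ⟨le_rfl, one_pos⟩
  have hd : ∀ r ∈ Set.Ioo (0 : ℝ) 1, _ := fun r hr =>
    hasDerivAt_deriv_of_contDiffOn hC (Icc_mem_nhds hr.1 hr.2)
  have hmem : ∀ s ∈ Set.Ioo 0 β, s / β ∈ Set.Ioo (0 : ℝ) 1 := fun s hs =>
    ⟨div_pos hs.1 hβ, (div_lt_one hβ).2 hs.2⟩
  have hinner : ∀ s, HasDerivAt (fun s => s / β) (1 / β) s := fun s =>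
    (hasDerivAt_id s).div_const β
  refine ⟨?_, ?_, ?_, ?_, ?_, ?_, ?_, ?_, ?_⟩
  · refine ContinuousOn.div_const (hC.continuousOn.comp (by fun_prop) ?_) _
    exact fun s hs => ⟨div_nonneg hs.1 hβ.le, (div_le_one hβ).2 hs.2⟩
  · intro s hs
    refine ContinuousAt.continuousWithinAt (ContinuousAt.div_const ?_ _)
    refine ContinuousAt.comp (f := fun s => s / β) (g := deriv u) ?_ (hinner s).continuousAt
    rcases hs.1.eq_or_lt with rfl | hs'
    · rw [zero_div]
      exact (differentiableAt_of_deriv_ne_zero (hr0.2.1 0 ⟨le_rfl, hr0.1.1⟩).ne).continuousAt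
    · exact (hd _ (hmem s ⟨hs', hs.2⟩)).2.continuousAt
  · simp [hM.ne']
  · simp [h0']
  · intro s hs
    have h := ((hd _ (hmem s hs)).1.comp s (hinner s)).div_const (u 0)
    refine h.congr_deriv ?_
    field_simp
  · intro s hs
    have h := ((hd _ (hmem s hs)).2.comp s (hinner s)).div_const (β * u 0)
    refine h.congr_deriv ?_
    field_simp
  · exact fun s hs => div_nonpos_of_nonpos_of_nonneg
      (hneg _ (Ioo_subset_Icc_self (hmem s hs))) (by positivity)
  · exact fun s hs => div_pos (hpos _ (Ioo_subset_Ico_self (hmem s hs))) hM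
  · intro s hs
    have hs' := hmem s hs
    have h := heq _ hs'
    rw [radialPucci_of_deriv_nonpos hs'.1 (hneg _ (Ioo_subset_Icc_self hs'))] at h
    have hc : 0 < β ^ 2 * u 0 := by positivity
    have hs0 : s ≠ 0 := hs.1.ne'
    have hmax := max_div_div_right hc.le (deriv (deriv u) (s / β)) 0
    have hmin := min_div_div_right hc.le (deriv (deriv u) (s / β)) 0
    rw [zero_div] at hmax hmin
    rw [hmax, hmin, div_rpow (hpos _ (Ioo_subset_Ico_self hs')).le hM.le, ← hβM, ← h]
    field_simp
    ring

/-- Asymptotics of the inflection radii: `r₀(n)^{2/(pₙ−1)}·Mₙ → R₀^{2/(p⋆−1)}`,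
`uₙ(r₀(n))/Mₙ → U(R₀)` and `r₀(n)^{2/(pₙ−1)}·uₙ(r₀(n)) → R₀^{2/(p⋆−1)}·U(R₀)`. -/
theorem stmt_7 (lam Lam : ℝ) (N : ℕ) (Ntil pstar c1 R0 : ℝ)
    (hlam : 0 < lam) (hlL : lam ≤ Lam) (hN : 2 ≤ N)
    (hNtil : Ntil = lam / Lam * ((N : ℝ) - 1) + 1) (hNtil2 : 2 < Ntil)
    (hpstar : 1 < pstar)
    (U : ℝ → ℝ) (hU : IsEntireSol lam Lam N Ntil pstar c1 R0 U)
    (hnonex : ¬ ∃ w : ℝ → ℝ, IsDirichletSol lam Lam N pstar w)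
    (ε : ℕ → ℝ) (hε : ∀ n, 0 < ε n) (hε0 : Tendsto ε atTop (nhds 0))
    (hpn : ∀ n, 1 < pstar - ε n)
    (u : ℕ → ℝ → ℝ) (hu : ∀ n, IsDirichletSol lam Lam N (pstar - ε n) (u n))
    (r0 : ℕ → ℝ) (hr0 : ∀ n, InflectionAt (u n) (r0 n)) :
    Tendsto (fun n => r0 n ^ (2 / (pstar - ε n - 1)) * u n 0) atTop
      (nhds (R0 ^ (2 / (pstar - 1)))) ∧
    Tendsto (fun n => u n (r0 n) / u n 0) atTop (nhds (U R0)) ∧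
    Tendsto (fun n => r0 n ^ (2 / (pstar - ε n - 1)) * u n (r0 n)) atTop
      (nhds (R0 ^ (2 / (pstar - 1)) * U R0)) := by
  have hk : (0 : ℝ) ≤ (N : ℝ) - 1 := by
    have : (2 : ℝ) ≤ N := by exact_mod_cast hN
    linarith
  have hM : ∀ n, 0 < u n 0 := fun n => (hu n).2.1 0 ⟨le_rfl, one_pos⟩
  set β : ℕ → ℝ := fun n => u n 0 ^ ((pstar - ε n - 1) / 2) with hβdef
  have hβ : ∀ n, 0 < β n := fun n => rpow_pos_of_pos (hM n) _
  have hβM : ∀ n, β n ^ 2 * u n 0 = u n 0 ^ (pstar - ε n) := by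
    intro n
    have : u n 0 ^ (pstar - ε n) = u n 0 ^ (pstar - ε n - 1) * u n 0 := by
      rw [← rpow_add_one (hM n).ne']; ring_nf
    rw [this, hβdef, ← rpow_mul_natCast (hM n).le]
    norm_num
  have hdiv : ∀ n, r0 n * β n / β n = r0 n := fun n => mul_div_cancel_right₀ _ (hβ n).ne'
  have hc : ∀ n, 0 < β n ^ 2 * u n 0 := fun n => mul_pos (pow_pos (hβ n) 2) (hM n)
  obtain ⟨hρ, hval⟩ := tendsto_inflection (ρ := fun n => r0 n * β n) (R := R0) (L := β)
    (v := fun n s => u n (s / β n) / u n 0)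
    hlam hlL hk hε hε0 hpn hU.isNormalizedIVPSol hβ
    (fun n => (hu n).isNormalizedIVPSol (hr0 n) (hβ n) (hβM n))
    (fun n => by simp [div_self (hβ n).ne', (hu n).2.2.1]) hU.2.2.2.2.2.2.1
    (fun r hr => hU.2.2.2.2.2.2.2.1 r (Ioo_subset_Ico_self hr)) hU.2.2.2.2.2.2.2.2.2.1
    (fun n => mul_pos (hr0 n).1.1 (hβ n))
    (fun n s hs => div_neg_of_neg_of_pos ((hr0 n).2.1 _
      ⟨div_nonneg hs.1.le (hβ n).le, (div_lt_iff₀ (hβ n)).2 hs.2⟩) (hc n))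
    (fun n s hs => div_pos ((hr0 n).2.2.2 _
      ⟨(lt_div_iff₀ (hβ n)).2 hs.1, (div_lt_one (hβ n)).2 hs.2⟩) (hc n))
  simp only [hdiv] at hval
  have hscale : ∀ n, (r0 n * β n) ^ (2 / (pstar - ε n - 1)) =
      r0 n ^ (2 / (pstar - ε n - 1)) * u n 0 := by
    intro n
    have hq : pstar - ε n - 1 ≠ 0 := by linarith [hpn n]
    rw [mul_rpow (hr0 n).1.1.le (hβ n).le, hβdef, ← rpow_mul (hM n).le]
    congr 1
    rw [show (pstar - ε n - 1) / 2 * (2 / (pstar - ε n - 1)) = 1 by field_simp, rpow_one]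
  have hexp : Tendsto (fun n => 2 / (pstar - ε n - 1)) atTop (nhds (2 / (pstar - 1))) := by
    refine tendsto_const_nhds.div ?_ (by linarith)
    simpa using (tendsto_const_nhds.sub hε0).sub_const 1
  have hfirst : Tendsto (fun n => r0 n ^ (2 / (pstar - ε n - 1)) * u n 0) atTop
      (nhds (R0 ^ (2 / (pstar - 1)))) := by
    simpa only [hscale] using hρ.rpow hexp (Or.inl hU.2.2.2.2.2.2.1.ne')
  refine ⟨hfirst, hval, (hfirst.mul hval).congr fun n => ?_⟩
  have := (hM n).ne'
  field_simp
end

section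
/- Let 0 < λ ≤ Λ and N ≥ 2 an integer with Ñ := (λ/Λ)(N−1) + 1 > 2. Assume: (a) there exists a normalized fast-decaying entire solution U at exponent p⋆ > 1, with fast-decay constant c₁ > 0; (b) the Dirichlet problem in the unit ball with exponent p⋆ has no positive radial solution. Let εₙ → 0⁺ with pₙ := p⋆ − εₙ > 1, let uₙ be positive radial solutions of the Dirichlet problem with exponent pₙ having a unique inflection radius r₀(n) ∈ (0,1), set Mₙ := uₙ(0), ρₙ := Mₙ^{(pₙ−1)/2} and ũₙ(r) := Mₙ⁻¹·uₙ(r/ρₙ). Let (rₙ) be a sequence with rₙ → +∞, rₙ ≤ ρₙ, and ρₙ/rₙ → l ∈ [1,+∞]. Then rₙ^{Ñ−2}·ũₙ(rₙ) → c₁·(1 − l^{2−Ñ}) as n → ∞, where l^{2−Ñ} is interpreted as 0 when l = +∞. -/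
open Real Filter Set

/-- A function with nonnegative derivative in the interior of an interval does not decrease. -/
lemma le_of_hasDerivAt_nonneg {f f' : ℝ → ℝ} {a b : ℝ} (hab : a ≤ b)
    (hc : ContinuousOn f (Icc a b)) (hd : ∀ x ∈ Ioo a b, HasDerivAt f (f' x) x)
    (h0 : ∀ x ∈ Ioo a b, 0 ≤ f' x) : f a ≤ f b := by
  have hmono : MonotoneOn f (Icc a b) := by
    refine monotoneOn_of_deriv_nonneg (convex_Icc a b) hc ?_ ?_
    · rw [interior_Icc]
      exact fun x hx => (hd x hx).differentiableAt.differentiableWithinAt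
    · rw [interior_Icc]
      intro x hx
      rw [(hd x hx).deriv]
      exact h0 x hx
  exact hmono (left_mem_Icc.2 hab) (right_mem_Icc.2 hab) hab

/-- The inverse of the increasing map `w ↦ Λ max(w,0) + λ min(w,0)`. -/
noncomputable def pucciInv (lam Lam y : ℝ) : ℝ := min (y / lam) (y / Lam)

lemma eq_pucciInv {lam Lam w y : ℝ} (hlam : 0 < lam) (hlL : lam ≤ Lam)
    (h : Lam * max w 0 + lam * min w 0 = y) : w = pucciInv lam Lam y := by
  have hLam : 0 < Lam := hlam.trans_le hlL
  unfold pucciInv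
  rcases le_total 0 w with hw | hw
  · rw [max_eq_left hw, min_eq_right hw] at h
    have hy : w = y / Lam := by
      field_simp
      linarith
    rw [min_eq_right, hy]
    rw [← h]
    have : 0 ≤ Lam * w + lam * 0 := by positivity
    gcongr
  · rw [max_eq_right hw, min_eq_left hw] at h
    have hy : w = y / lam := by
      field_simp
      linarith
    rw [min_eq_left, hy]
    rw [div_le_div_iff₀ hlam hLam]
    have : y ≤ 0 := by
      rw [← h]
      nlinarith
    nlinarith

lemma pucciInv_eq_of_pos {lam Lam y : ℝ} (hlam : 0 < lam) (hlL : lam ≤ Lam)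
    (h : 0 < pucciInv lam Lam y) : pucciInv lam Lam y = y / Lam := by
  have hLam : 0 < Lam := hlam.trans_le hlL
  unfold pucciInv at h ⊢
  have hy : 0 < y := by
    have := (lt_min_iff.1 h).2
    exact (div_pos_iff_of_pos_right hLam).1 this
  rw [min_eq_right]
  gcongr

lemma continuous_pucciInv (lam Lam : ℝ) : Continuous (pucciInv lam Lam) := by
  unfold pucciInv
  fun_prop

/-- The increment of `pucciInv` is the increment of the argument times a slope in `[0, 1/λ]`. -/
lemma exists_pucciInv_sub {lam Lam : ℝ} (hlam : 0 < lam) (hlL : lam ≤ Lam) (x y : ℝ) :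
    ∃ k, 0 ≤ k ∧ k ≤ 1 / lam ∧ pucciInv lam Lam x - pucciInv lam Lam y = k * (x - y) := by
  have hLam : 0 < Lam := hlam.trans_le hlL
  have key : ∀ x y : ℝ, y < x → 0 ≤ pucciInv lam Lam x - pucciInv lam Lam y ∧
      pucciInv lam Lam x - pucciInv lam Lam y ≤ (1 / lam) * (x - y) := by
    intro x y hxy
    have h1 : y / lam ≤ x / lam := by gcongr
    have h2 : y / Lam ≤ x / Lam := by gcongr
    have h3 : (1 / lam) * (x - y) = x / lam - y / lam := by ring
    have h4 : x / Lam - y / Lam ≤ x / lam - y / lam := by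
      rw [← sub_div, ← sub_div]
      have : 0 ≤ x - y := by linarith
      gcongr
    unfold pucciInv
    constructor
    · have := min_le_min h1 h2
      linarith
    · rw [h3]
      rcases min_choice (y / lam) (y / Lam) with h | h <;> rw [h]
      · linarith [min_le_left (x / lam) (x / Lam)]
      · linarith [min_le_right (x / lam) (x / Lam)]
  rcases lt_trichotomy y x with h | h | h
  · obtain ⟨h1, h2⟩ := key x y h
    have hpos : 0 < x - y := by linarith
    refine ⟨(pucciInv lam Lam x - pucciInv lam Lam y) / (x - y), by positivity, ?_, ?_⟩
    · rw [div_le_iff₀ hpos]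
      exact h2
    · field_simp
  · exact ⟨0, le_rfl, by positivity, by simp [h]⟩
  · obtain ⟨h1, h2⟩ := key y x h
    have hpos : 0 < y - x := by linarith
    refine ⟨(pucciInv lam Lam y - pucciInv lam Lam x) / (y - x), by positivity, ?_, ?_⟩
    · rw [div_le_iff₀ hpos]
      exact h2
    · field_simp
      ring

/-- A radial solution on `[0, ρ)` of `-M⁺[u] = u^p` with `u(0) = 1`, written as a first-order
system for `u` and `v = u'`; here `k = N - 1`. -/
structure IsRadialSol (lam Lam k p ρ : ℝ) (u v : ℝ → ℝ) : Prop where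
  continuousOn_fst : ContinuousOn u (Ico 0 ρ)
  continuousOn_snd : ContinuousOn v (Ico 0 ρ)
  fst_zero : u 0 = 1
  snd_zero : v 0 = 0
  pos : ∀ r ∈ Ico 0 ρ, 0 < u r
  nonpos : ∀ r ∈ Ico 0 ρ, v r ≤ 0
  hasDerivAt_fst : ∀ r ∈ Ioo 0 ρ, HasDerivAt u (v r) r
  hasDerivAt_snd : ∀ r ∈ Ioo 0 ρ,
    HasDerivAt v (pucciInv lam Lam (-(u r) ^ p - lam * k * (v r / r))) r

lemma IsRadialSol.le_one {lam Lam k p ρ : ℝ} {u v : ℝ → ℝ} (h : IsRadialSol lam Lam k p ρ u v)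
    {r : ℝ} (hr : r ∈ Ico 0 ρ) : u r ≤ 1 := by
  have hsub : Icc 0 r ⊆ Ico 0 ρ := fun x hx => ⟨hx.1, hx.2.trans_lt hr.2⟩
  have := le_of_hasDerivAt_nonneg (f := fun x => -u x) (f' := fun x => -v x) hr.1
    (h.continuousOn_fst.mono hsub).neg
    (fun x hx => (h.hasDerivAt_fst x ⟨hx.1, hx.2.trans hr.2⟩).neg)
    (fun x hx => by
      have := h.nonpos x ⟨hx.1.le, hx.2.trans hr.2⟩
      linarith)
  simp only [h.fst_zero] at this
  linarith

lemma abs_rpow_sub_rpow_le {p x y : ℝ} (hp : 1 < p) (hx : 0 < x) (hx1 : x ≤ 1) (hy : 0 < y)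
    (hy1 : y ≤ 1) : |x ^ p - y ^ p| ≤ p * |x - y| := by
  have := Convex.norm_image_sub_le_of_norm_hasDerivWithin_le (f := fun t : ℝ => t ^ p)
    (f' := fun t => p * t ^ (p - 1)) (s := Ioc 0 1) (C := p) (x := y) (y := x)
    (fun t ht => (Real.hasDerivAt_rpow_const (Or.inl ht.1.ne')).hasDerivWithinAt)
    (fun t ht => by
      have h1 : t ^ (p - 1) ≤ 1 := Real.rpow_le_one ht.1.le ht.2 (by linarith)
      have h2 : 0 ≤ t ^ (p - 1) := Real.rpow_nonneg ht.1.le _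
      rw [Real.norm_eq_abs, abs_of_nonneg (by positivity)]
      nlinarith)
    (convex_Ioc 0 1) ⟨hy, hy1⟩ ⟨hx, hx1⟩
  simpa [Real.norm_eq_abs] using this

lemma abs_rpow_sub_rpow_exponent_le {p q x : ℝ} (hp : 1 < p) (hpq : p ≤ q) (hx : 0 < x)
    (hx1 : x ≤ 1) : |x ^ p - x ^ q| ≤ q - p := by
  have h1 : x ^ q ≤ x ^ p := Real.rpow_le_rpow_of_exponent_ge hx hx1 hpq
  rw [abs_of_nonneg (by linarith)]
  have h2 : x ^ q = x ^ p * x ^ (q - p) := by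
    rw [← Real.rpow_add hx]
    ring_nf
  have h3 : 1 + Real.log x * (q - p) ≤ x ^ (q - p) := by
    rw [Real.rpow_def_of_pos hx]
    linarith [Real.add_one_le_exp (Real.log x * (q - p))]
  have h4 : x ^ p ≤ x := by
    simpa using Real.rpow_le_rpow_of_exponent_ge hx hx1 hp.le
  have h5 : x * (-Real.log x) ≤ 1 := by
    have := Real.one_sub_inv_le_log_of_pos hx
    have h6 : x * x⁻¹ = 1 := mul_inv_cancel₀ hx.ne'
    nlinarith
  have h7 : 0 ≤ -Real.log x := by linarith [Real.log_nonpos hx.le hx1]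
  have h8 : 0 < x ^ p := Real.rpow_pos_of_pos hx p
  have h9 : x ^ p * (-Real.log x) ≤ 1 := (mul_le_mul_of_nonneg_right h4 h7).trans h5
  rw [h2]
  nlinarith

/-- Continuous dependence on the exponent: the singular term `u'/r` is dissipative. -/
lemma IsRadialSol.sq_dist_le {lam Lam k p q ρ ρ' : ℝ} {u v u' v' : ℝ → ℝ} (hlam : 0 < lam)
    (hlL : lam ≤ Lam) (hk : 0 ≤ k) (hp : 1 < p) (hpq : p ≤ q)
    (h : IsRadialSol lam Lam k p ρ u v) (h' : IsRadialSol lam Lam k q ρ' u' v') {R : ℝ}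
    (hR : 0 ≤ R) (hRρ : R < ρ) (hRρ' : R < ρ') :
    (u R - u' R) ^ 2 + (v R - v' R) ^ 2 ≤
      (q - p) ^ 2 / lam * R * Real.exp ((1 + (q + 1) / lam) * R) := by
  set K := 1 + (q + 1) / lam with hK
  set e := q - p with he
  have hsub : Icc 0 R ⊆ Ico 0 ρ := fun x hx => ⟨hx.1, hx.2.trans_lt hRρ⟩
  have hsub' : Icc 0 R ⊆ Ico 0 ρ' := fun x hx => ⟨hx.1, hx.2.trans_lt hRρ'⟩
  set E : ℝ → ℝ := fun r => (u r - u' r) ^ 2 + (v r - v' r) ^ 2 with hE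
  set y : ℝ → ℝ := fun r => -(u r) ^ p - lam * k * (v r / r)
  set y' : ℝ → ℝ := fun r => -(u' r) ^ q - lam * k * (v' r / r)
  set E' : ℝ → ℝ := fun r => 2 * (u r - u' r) * (v r - v' r) +
    2 * (v r - v' r) * (pucciInv lam Lam (y r) - pucciInv lam Lam (y' r)) with hE'
  have hcE : ContinuousOn E (Icc 0 R) :=
    (((h.continuousOn_fst.mono hsub).sub (h'.continuousOn_fst.mono hsub')).pow 2).add
      (((h.continuousOn_snd.mono hsub).sub (h'.continuousOn_snd.mono hsub')).pow 2)
  have hdE : ∀ r ∈ Ioo 0 R, HasDerivAt E (E' r) r := by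
    intro r hr
    have hr1 : r ∈ Ioo 0 ρ := ⟨hr.1, hr.2.trans hRρ⟩
    have hr2 : r ∈ Ioo 0 ρ' := ⟨hr.1, hr.2.trans hRρ'⟩
    have d1 := ((h.hasDerivAt_fst r hr1).sub (h'.hasDerivAt_fst r hr2)).pow 2
    have d2 := ((h.hasDerivAt_snd r hr1).sub (h'.hasDerivAt_snd r hr2)).pow 2
    refine (d1.add d2).congr_deriv ?_
    simp [hE', y, y']
  have hbound : ∀ r ∈ Ioo 0 R, E' r ≤ K * E r + e ^ 2 / lam := by
    intro r hr
    have hr1 : r ∈ Ico 0 ρ := ⟨hr.1.le, hr.2.trans hRρ⟩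
    have hr2 : r ∈ Ico 0 ρ' := ⟨hr.1.le, hr.2.trans hRρ'⟩
    obtain ⟨c, hc0, hc1, hc⟩ := exists_pucciInv_sub hlam hlL (y r) (y' r)
    have hpow : |(u r) ^ p - (u' r) ^ q| ≤ q * |u r - u' r| + e := by
      have b1 := abs_rpow_sub_rpow_le hp (h.pos r hr1) (h.le_one hr1) (h'.pos r hr2)
        (h'.le_one hr2)
      have b2 := abs_rpow_sub_rpow_exponent_le hp hpq (h'.pos r hr2) (h'.le_one hr2)
      have b3 := abs_sub_le (u r ^ p) (u' r ^ p) (u' r ^ q)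
      have b4 : p * |u r - u' r| ≤ q * |u r - u' r| := by gcongr
      linarith
    simp only [hE', hE]
    rw [hc]
    set d := u r - u' r
    set d' := v r - v' r with hd'
    have hy : y r - y' r = -(u r ^ p - u' r ^ q) - lam * k * (d' / r) := by
      simp only [y, y', hd']
      ring
    rw [hy]
    set W := u r ^ p - u' r ^ q
    have hlamk : 0 ≤ c * (lam * k * (d' ^ 2 / r)) := by
      have := hr.1
      positivity
    have t1 : 2 * d * d' ≤ d ^ 2 + d' ^ 2 := two_mul_le_add_sq d d'
    have t2 : -(d' * W) ≤ |d'| * (q * |d| + e) := by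
      calc -(d' * W) ≤ |d' * W| := neg_le_abs _
        _ = |d'| * |W| := abs_mul _ _
        _ ≤ _ := by gcongr
    have t3 : 2 * (|d'| * (q * |d| + e)) ≤ q * (d ^ 2 + d' ^ 2) + (e ^ 2 + (d ^ 2 + d' ^ 2)) := by
      have a1 : 2 * (|d| * |d'|) ≤ d ^ 2 + d' ^ 2 := by
        nlinarith [sq_nonneg (|d| - |d'|), sq_abs d, sq_abs d']
      have a2 : 2 * (|d'| * e) ≤ e ^ 2 + d' ^ 2 := by
        nlinarith [sq_nonneg (|d'| - e), sq_abs d']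
      nlinarith [sq_nonneg d]
    have t4 : c * (2 * (-(d' * W))) ≤
        (1 / lam) * (q * (d ^ 2 + d' ^ 2) + (e ^ 2 + (d ^ 2 + d' ^ 2))) := by
      have hq : 0 < q := by linarith
      have : 0 ≤ q * (d ^ 2 + d' ^ 2) + (e ^ 2 + (d ^ 2 + d' ^ 2)) := by positivity
      calc c * (2 * (-(d' * W))) ≤ c * (q * (d ^ 2 + d' ^ 2) + (e ^ 2 + (d ^ 2 + d' ^ 2))) := by
            apply mul_le_mul_of_nonneg_left _ hc0
            linarith
        _ ≤ _ := by gcongr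
    have t5 : 2 * d' * (c * (-W - lam * k * (d' / r))) =
        c * (2 * (-(d' * W))) - 2 * (c * (lam * k * (d' ^ 2 / r))) := by ring
    have t6 : K * (d ^ 2 + d' ^ 2) + e ^ 2 / lam = (d ^ 2 + d' ^ 2) +
        (1 / lam) * (q * (d ^ 2 + d' ^ 2) + (e ^ 2 + (d ^ 2 + d' ^ 2))) := by
      rw [hK]
      ring
    rw [t5, t6]
    linarith
  have hfin := le_of_hasDerivAt_nonneg (f := fun r => e ^ 2 / lam * r - Real.exp (-K * r) * E r)
    (f' := fun r => e ^ 2 / lam - (Real.exp (-K * r) * (-K) * E r + Real.exp (-K * r) * E' r))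
    hR (((continuous_const.mul continuous_id).continuousOn).sub
      ((by fun_prop : Continuous fun r => Real.exp (-K * r)).continuousOn.mul hcE))
    (fun r hr => by
      have d1 : HasDerivAt (fun r => e ^ 2 / lam * r) (e ^ 2 / lam) r := by
        simpa using (hasDerivAt_id r).const_mul (e ^ 2 / lam)
      have d2 : HasDerivAt (fun r => Real.exp (-K * r)) (Real.exp (-K * r) * (-K)) r := by
        simpa using ((hasDerivAt_id r).const_mul (-K)).exp
      exact d1.sub (d2.mul (hdE r hr)))
    (fun r hr => by
      have b := hbound r hr
      have hexp : Real.exp (-K * r) ≤ 1 := by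
        rw [Real.exp_le_one_iff]
        have : 0 ≤ K := by
          rw [hK]
          have : 0 < q := by linarith
          positivity
        nlinarith [hr.1]
      have hpos := Real.exp_pos (-K * r)
      have : 0 ≤ e ^ 2 / lam := by positivity
      have hb : Real.exp (-K * r) * (E' r - K * E r) ≤ e ^ 2 / lam := by
        calc Real.exp (-K * r) * (E' r - K * E r) ≤ Real.exp (-K * r) * (e ^ 2 / lam) := by
              gcongr
              linarith
          _ ≤ 1 * (e ^ 2 / lam) := by gcongr
          _ = _ := one_mul _
      linarith)
  have hE0 : E 0 = 0 := by
    simp [hE, h.fst_zero, h'.fst_zero, h.snd_zero, h'.snd_zero]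
  simp only [hE0, mul_zero, sub_zero] at hfin
  have hmul : Real.exp (-K * R) * Real.exp (K * R) = 1 := by
    rw [← Real.exp_add]
    simp
  have hle : Real.exp (-K * R) * E R ≤ e ^ 2 / lam * R := by linarith
  calc E R = (Real.exp (-K * R) * E R) * Real.exp (K * R) := by
        rw [mul_right_comm, hmul, one_mul]
    _ ≤ _ := by gcongr

/-- A positive, nonincreasing, convex solution of `w'' + (m+1)/t w' + μ w^p = 0` on `[s, T)`
that vanishes at `T`, written as a first-order system for `w` and `z = w'`. -/
structure IsEmdenSol (m μ p s T : ℝ) (w z : ℝ → ℝ) : Prop where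
  start_pos : 0 < s
  coeff_pos : 0 < μ
  continuousOn : ContinuousOn w (Icc s T)
  end_eq_zero : w T = 0
  pos : ∀ t ∈ Ico s T, 0 < w t
  nonpos : ∀ t ∈ Ico s T, z t ≤ 0
  hasDerivAt_fst : ∀ t ∈ Ico s T, HasDerivAt w (z t) t
  hasDerivAt_snd : ∀ t ∈ Ico s T, HasDerivAt z (-(m + 1) * (z t / t) - μ * (w t) ^ p) t
  convex : ∀ t ∈ Ico s T, 0 < -(m + 1) * (z t / t) - μ * (w t) ^ p

namespace IsEmdenSol

variable {m μ p s T : ℝ} {w z : ℝ → ℝ}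

lemma mono (h : IsEmdenSol m μ p s T w z) {r : ℝ} (hr : s ≤ r) :
    IsEmdenSol m μ p r T w z where
  start_pos := h.start_pos.trans_le hr
  coeff_pos := h.coeff_pos
  continuousOn := h.continuousOn.mono (Icc_subset_Icc_left hr)
  end_eq_zero := h.end_eq_zero
  pos := fun t ht => h.pos t (Ico_subset_Ico_left hr ht)
  nonpos := fun t ht => h.nonpos t (Ico_subset_Ico_left hr ht)
  hasDerivAt_fst := fun t ht => h.hasDerivAt_fst t (Ico_subset_Ico_left hr ht)
  hasDerivAt_snd := fun t ht => h.hasDerivAt_snd t (Ico_subset_Ico_left hr ht)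
  convex := fun t ht => h.convex t (Ico_subset_Ico_left hr ht)

lemma continuousOn_snd (h : IsEmdenSol m μ p s T w z) : ContinuousOn z (Ico s T) :=
  fun t ht => (h.hasDerivAt_snd t ht).continuousAt.continuousWithinAt

lemma antitone (h : IsEmdenSol m μ p s T w z) {a b : ℝ} (ha : s ≤ a) (hab : a ≤ b) (hb : b ≤ T) :
    w b ≤ w a := by
  have := le_of_hasDerivAt_nonneg (f := fun x => -w x) (f' := fun x => -z x) hab
    (h.continuousOn.mono (Icc_subset_Icc ha hb)).neg
    (fun x hx => (h.hasDerivAt_fst x ⟨ha.trans hx.1.le, hx.2.trans_le hb⟩).neg)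
    (fun x hx => by
      have := h.nonpos x ⟨ha.trans hx.1.le, hx.2.trans_le hb⟩
      linarith)
  linarith

lemma hasDerivAt_flux (h : IsEmdenSol m μ p s T w z) {t : ℝ} (ht : t ∈ Ico s T) :
    HasDerivAt (fun t => -(t ^ (m + 1) * z t)) (μ * (t ^ (m + 1) * (w t) ^ p)) t := by
  have ht0 : 0 < t := h.start_pos.trans_le ht.1
  have d1 : HasDerivAt (fun t : ℝ => t ^ (m + 1)) ((m + 1) * t ^ m) t := by
    simpa using Real.hasDerivAt_rpow_const (p := m + 1) (Or.inl ht0.ne')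
  refine (d1.mul (h.hasDerivAt_snd t ht)).neg.congr_deriv ?_
  rw [Real.rpow_add_one ht0.ne']
  field_simp
  ring

lemma flux_mono (h : IsEmdenSol m μ p s T w z) {a b : ℝ} (ha : s ≤ a) (hab : a ≤ b) (hb : b < T) :
    -(a ^ (m + 1) * z a) ≤ -(b ^ (m + 1) * z b) := by
  have hmem : ∀ x ∈ Icc a b, x ∈ Ico s T := fun x hx => ⟨ha.trans hx.1, hx.2.trans_lt hb⟩
  exact le_of_hasDerivAt_nonneg (f := fun t => -(t ^ (m + 1) * z t)) hab
    (fun x hx => (h.hasDerivAt_flux (hmem x hx)).continuousAt.continuousWithinAt)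
    (fun x hx => h.hasDerivAt_flux (hmem x (Ioo_subset_Icc_self hx)))
    (fun x hx => by
      have hx' := hmem x (Ioo_subset_Icc_self hx)
      have h1 := h.pos x hx'
      have h2 := h.start_pos.trans_le hx'.1
      have h3 := h.coeff_pos
      positivity)

/-- Rescaling to the normalization `w(1) = 1`. -/
lemma rescale (h : IsEmdenSol m μ p s T w z) (hsT : s < T) :
    IsEmdenSol m (μ * (s ^ 2 * w s ^ (p - 1))) p 1 (T / s) (fun t => w (s * t) / w s)
      (fun t => s * z (s * t) / w s) := by
  have hs := h.start_pos
  have hw : 0 < w s := h.pos s ⟨le_rfl, hsT⟩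
  have hmem : ∀ t ∈ Ico 1 (T / s), s * t ∈ Ico s T := by
    intro t ht
    constructor
    · nlinarith [ht.1]
    · have := (lt_div_iff₀ hs).1 ht.2
      linarith
  have hid : ∀ t, HasDerivAt (fun t => s * t) s t := fun t => by
    simpa using (hasDerivAt_id t).const_mul s
  have heq : ∀ t ∈ Ico 1 (T / s), -(m + 1) * (s * z (s * t) / w s / t) -
      μ * (s ^ 2 * w s ^ (p - 1)) * (w (s * t) / w s) ^ p =
      s ^ 2 / w s * (-(m + 1) * (z (s * t) / (s * t)) - μ * (w (s * t)) ^ p) := by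
    intro t ht
    have ht0 : 0 < t := by linarith [ht.1]
    have h1 := h.pos _ (hmem t ht)
    rw [Real.div_rpow h1.le hw.le, Real.rpow_sub_one hw.ne']
    have := Real.rpow_pos_of_pos hw p
    field_simp
  refine ⟨one_pos, ?_, ?_, ?_, ?_, ?_, ?_, ?_, ?_⟩
  · have := h.coeff_pos
    positivity
  · refine ContinuousOn.div_const (h.continuousOn.comp (by fun_prop) ?_) _
    intro t ht
    constructor
    · nlinarith [ht.1]
    · have := (le_div_iff₀ hs).1 ht.2
      linarith
  · simp [mul_div_cancel₀ T hs.ne', h.end_eq_zero]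
  · intro t ht
    have := h.pos _ (hmem t ht)
    positivity
  · intro t ht
    have := h.nonpos _ (hmem t ht)
    apply div_nonpos_of_nonpos_of_nonneg _ hw.le
    nlinarith
  · intro t ht
    have := ((h.hasDerivAt_fst _ (hmem t ht)).comp t (hid t)).div_const (w s)
    refine this.congr_deriv ?_
    ring
  · intro t ht
    have := (((h.hasDerivAt_snd _ (hmem t ht)).comp t (hid t)).const_mul s).div_const (w s)
    refine this.congr_deriv ?_
    rw [heq t ht]
    ring
  · intro t ht
    rw [heq t ht]
    have := h.convex _ (hmem t ht)
    positivity

end IsEmdenSol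

/-- A convex solution that starts with logarithmic slope weaker than that of the fundamental
solution `t^{-m}` cannot have a small coefficient: otherwise it would stay close to a positive
constant for so long that it becomes concave. -/
lemma exists_le_coeff_of_isEmdenSol {m a P : ℝ} (hm : 0 < m) (ha : 0 < a) (ham : a < m)
    (hP : 1 ≤ P) : ∃ δ > 0, ∀ (p μ T : ℝ) (w z : ℝ → ℝ), 1 < p → p ≤ P → 1 < T →
      IsEmdenSol m μ p 1 T w z → w 1 = 1 → -z 1 ≤ a → δ ≤ μ := by
  set c := 1 - a / m with hc
  have hc0 : 0 < c := by
    rw [hc, sub_pos, div_lt_one hm]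
    exact ham
  have hc1 : c < 1 := by
    have : 0 < a / m := by positivity
    linarith
  set κ := (m + 2) * (c / (8 * P)) with hκ
  have hκ0 : 0 < κ := by positivity
  set e := (c / 2) ^ P / (2 * (m + 2)) with he
  have he0 : 0 < e := by positivity
  obtain ⟨σ, hσ1, hσ⟩ : ∃ σ : ℝ, 1 ≤ σ ∧ a * σ ^ (-m) ≤ c / (8 * P) := by
    have h1 : Tendsto (fun σ : ℝ => a * σ ^ (-m)) atTop (nhds (a * 0)) :=
      (tendsto_rpow_neg_atTop hm).const_mul a
    rw [mul_zero] at h1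
    have h2 : (0 : ℝ) < c / (8 * P) := by positivity
    obtain ⟨σ, h3, h4⟩ := ((h1.eventually_lt_const h2).and (eventually_ge_atTop 1)).exists
    exact ⟨σ, h4, h3.le⟩
  obtain ⟨T0, hT0, hT0'⟩ : ∃ T0 : ℝ, σ ≤ T0 ∧ ∀ τ, T0 ≤ τ →
      (m + 1) * (a + κ * σ ^ (m + 2) / (m + 2)) + κ * e * σ ^ (m + 2) < e * (κ * τ ^ m) := by
    have h1 : Tendsto (fun τ : ℝ => e * (κ * τ ^ m)) atTop atTop :=
      ((tendsto_rpow_atTop hm).const_mul_atTop hκ0).const_mul_atTop he0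
    obtain ⟨T1, hT1⟩ := eventually_atTop.1 (h1.eventually_gt_atTop
      ((m + 1) * (a + κ * σ ^ (m + 2) / (m + 2)) + κ * e * σ ^ (m + 2)))
    exact ⟨max σ T1, le_max_left _ _, fun τ hτ => hT1 τ ((le_max_right _ _).trans hτ)⟩
  have hT00 : 0 < T0 := by linarith
  refine ⟨κ / T0 ^ 2, by positivity, ?_⟩
  intro p μ T w z hp hpP hT h hw1 hz1
  by_contra! hμ
  have hμ0 := h.coeff_pos
  set τ := √(κ / μ) with hτ
  have hτ2 : μ * τ ^ 2 = κ := by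
    rw [hτ, Real.sq_sqrt (by positivity)]
    field_simp
  have hτT0 : T0 ≤ τ := by
    apply Real.le_sqrt_of_sq_le
    rw [le_div_iff₀ hμ0]
    rw [lt_div_iff₀ (by positivity)] at hμ
    linarith
  have hτ1 : 1 ≤ τ := by linarith
  have hμκ : μ ≤ κ := by
    have : 1 ≤ τ ^ 2 := by nlinarith
    nlinarith
  have hpw : ∀ t : ℝ, 0 < t → t ^ (m + 1) * t = t ^ (m + 2) := fun t ht => by
    rw [← Real.rpow_add_one ht.ne']
    ring_nf
  have hpw' : ∀ t : ℝ, 0 < t → t ^ (m + 1) = t ^ m * t := fun t ht =>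
    Real.rpow_add_one ht.ne' m
  have hdpow : ∀ t : ℝ, 0 < t → HasDerivAt (fun t : ℝ => t ^ (m + 2)) ((m + 2) * t ^ (m + 1)) t :=
    fun t ht => by
      refine (Real.hasDerivAt_rpow_const (p := m + 2) (Or.inl ht.ne')).congr_deriv ?_
      ring_nf
  have hle1 : ∀ t ∈ Ico 1 T, w t ≤ 1 := fun t ht => hw1 ▸ h.antitone le_rfl ht.1 ht.2.le
  have hG : ∀ t ∈ Ico 1 T, -(t ^ (m + 1) * z t) ≤ a + μ * t ^ (m + 2) / (m + 2) := by
    intro t ht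
    have hmem : ∀ x ∈ Icc 1 t, x ∈ Ico 1 T := fun x hx => ⟨hx.1, hx.2.trans_lt ht.2⟩
    have hd : ∀ x ∈ Icc 1 t, HasDerivAt
        (fun x => a + μ * x ^ (m + 2) / (m + 2) - -(x ^ (m + 1) * z x))
        (μ * x ^ (m + 1) - μ * (x ^ (m + 1) * (w x) ^ p)) x := by
      intro x hx
      have hx0 : 0 < x := by linarith [hx.1]
      refine (((((hdpow x hx0).const_mul μ).div_const (m + 2)).const_add a).sub
        (h.hasDerivAt_flux (hmem x hx))).congr_deriv ?_
      field_simp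
    have := le_of_hasDerivAt_nonneg ht.1
      (fun x hx => (hd x hx).continuousAt.continuousWithinAt)
      (fun x hx => hd x (Ioo_subset_Icc_self hx))
      (fun x hx => by
        have hx' := hmem x (Ioo_subset_Icc_self hx)
        have hx0 : 0 < x := by linarith [hx.1]
        have h1 : w x ^ p ≤ 1 := Real.rpow_le_one (h.pos x hx').le (hle1 x hx') (by linarith)
        have h2 := Real.rpow_pos_of_pos hx0 (m + 1)
        have h3 : 0 < μ * x ^ (m + 1) := by positivity
        nlinarith)
    simp only [Real.one_rpow] at this
    have h5 : 0 ≤ μ * 1 / (m + 2) := by positivity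
    linarith
  have hW : ∀ t ∈ Icc 1 T, c - μ * t ^ 2 / (2 * (m + 2)) ≤ w t := by
    intro t ht
    have hmem : ∀ x ∈ Ioo 1 t, x ∈ Ico 1 T := fun x hx => ⟨hx.1.le, hx.2.trans_le ht.2⟩
    have := le_of_hasDerivAt_nonneg
      (f := fun x => w x - a * x ^ (-m) / m + μ * x ^ 2 / (2 * (m + 2)))
      (f' := fun x => z x + a * x ^ (-m - 1) + μ * x / (m + 2)) ht.1
      (by
        refine ContinuousOn.add (ContinuousOn.sub
          (h.continuousOn.mono (Icc_subset_Icc_right ht.2)) ?_) (by fun_prop)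
        refine ContinuousOn.div_const (continuousOn_const.mul ?_) _
        exact ContinuousOn.rpow_const continuousOn_id
          (fun x hx => Or.inl (zero_lt_one.trans_le hx.1).ne'))
      (fun x hx => by
        have hx0 : 0 < x := by linarith [hx.1]
        have d1 := h.hasDerivAt_fst x (hmem x hx)
        have d2 := ((Real.hasDerivAt_rpow_const (p := -m) (Or.inl hx0.ne')).const_mul a).div_const m
        have d3 := (((hasDerivAt_id x).pow 2).const_mul μ).div_const (2 * (m + 2))
        refine ((d1.sub d2).add d3).congr_deriv ?_
        simp only [id]
        field_simp
        ring)
      (fun x hx => by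
        have hx0 : 0 < x := by linarith [hx.1]
        have hg := hG x (hmem x hx)
        have hinv : x ^ (-m - 1) = (x ^ (m + 1))⁻¹ := by
          rw [← Real.rpow_neg hx0.le]
          ring_nf
        rw [hinv]
        have hq := Real.rpow_pos_of_pos hx0 (m + 1)
        rw [← hpw x hx0] at hg
        have : 0 ≤ x ^ (m + 1) * (z x + a * (x ^ (m + 1))⁻¹ + μ * x / (m + 2)) := by
          have e1 : x ^ (m + 1) * (z x + a * (x ^ (m + 1))⁻¹ + μ * x / (m + 2)) =
            x ^ (m + 1) * z x + a + μ * (x ^ (m + 1) * x) / (m + 2) := by field_simp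
          rw [e1]
          linarith
        exact nonneg_of_mul_nonneg_right this hq)
    have ht0 : 0 < t := by linarith [ht.1]
    simp only [Real.one_rpow, hw1] at this
    have h5 : 0 ≤ μ * 1 ^ 2 / (2 * (m + 2)) := by positivity
    have h6 : 0 ≤ a * t ^ (-m) / m := by positivity
    have h7 : a * 1 / m = a / m := by ring
    rw [hc]
    linarith
  have hκc : κ ≤ (m + 2) * c := by
    rw [hκ]
    gcongr
    apply div_le_self hc0.le
    linarith
  have hτT : τ < T := by
    by_contra! hTτ
    have h1 := hW T ⟨hT.le, le_rfl⟩
    rw [h.end_eq_zero] at h1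
    have h2 : μ * T ^ 2 ≤ κ := by
      rw [← hτ2]
      gcongr
    have h3 : μ * T ^ 2 / (2 * (m + 2)) ≤ c / 2 := by
      rw [div_le_iff₀ (by positivity)]
      linarith
    linarith
  have hmemτ : ∀ t ∈ Icc σ τ, t ∈ Ico 1 T := fun t ht => ⟨hσ1.trans ht.1, ht.2.trans_lt hτT⟩
  have hμt : ∀ t ∈ Icc σ τ, μ * t ^ 2 ≤ κ := fun t ht => by
    rw [← hτ2]
    have : 0 ≤ t := by linarith [ht.1]
    have := ht.2
    gcongr
  have hhalf : ∀ t ∈ Icc σ τ, c / 2 ≤ w t := by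
    intro t ht
    have h1 := hW t (Ico_subset_Icc_self (hmemτ t ht))
    have h3 : μ * t ^ 2 / (2 * (m + 2)) ≤ c / 2 := by
      rw [div_le_iff₀ (by positivity)]
      linarith [hμt t ht]
    linarith
  have hslope : ∀ t ∈ Icc σ τ, p * (t * -z t) ≤ w t / 2 := by
    intro t ht
    have ht0 : 0 < t := by linarith [ht.1]
    have hg := hG t (hmemτ t ht)
    rw [← hpw t ht0, hpw' t ht0] at hg
    have hq := Real.rpow_pos_of_pos ht0 m
    have h1 : t * -z t ≤ a * t ^ (-m) + μ * t ^ 2 / (m + 2) := by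
      rw [Real.rpow_neg ht0.le]
      have e1 : t ^ m * (t * -z t) ≤ t ^ m * (a * (t ^ m)⁻¹ + μ * t ^ 2 / (m + 2)) := by
        have e2 : t ^ m * (a * (t ^ m)⁻¹ + μ * t ^ 2 / (m + 2)) =
          a + μ * (t ^ m * t * t) / (m + 2) := by field_simp
        rw [e2]
        linarith
      exact le_of_mul_le_mul_left e1 hq
    have h2 : a * t ^ (-m) ≤ c / (8 * P) := by
      refine le_trans ?_ hσ
      have : t ^ (-m) ≤ σ ^ (-m) :=
        Real.rpow_le_rpow_of_nonpos (by linarith) ht.1 (by linarith)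
      gcongr
    have h3 : μ * t ^ 2 / (m + 2) ≤ c / (8 * P) := by
      rw [div_le_iff₀ (by positivity)]
      linarith [hμt t ht]
    have h4 : t * -z t ≤ c / (4 * P) := by
      have : c / (4 * P) = c / (8 * P) + c / (8 * P) := by
        field_simp
        norm_num
      linarith
    calc p * (t * -z t) ≤ P * (c / (4 * P)) := by
          apply mul_le_mul hpP h4 _ (by linarith)
          have := h.nonpos t (hmemτ t ht)
          nlinarith
      _ = (c / 2) / 2 := by
          field_simp
          norm_num
      _ ≤ w t / 2 := by linarith [hhalf t ht]
  have hστ : σ ≤ τ := hT0.trans hτT0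
  set B : ℝ → ℝ := fun t => (m + 1) * -(t ^ (m + 1) * z t) - μ * (t ^ (m + 2) * (w t) ^ p) with hB
  have hdB : ∀ t ∈ Icc σ τ, HasDerivAt (fun t => -(B t + μ * e * t ^ (m + 2)))
      (-((m + 1) * (μ * (t ^ (m + 1) * (w t) ^ p)) - μ * ((m + 2) * t ^ (m + 1) * (w t) ^ p +
        t ^ (m + 2) * (z t * p * (w t) ^ (p - 1))) + μ * e * ((m + 2) * t ^ (m + 1)))) t := by
    intro t ht
    have ht0 : 0 < t := by linarith [ht.1]
    have ht' := hmemτ t ht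
    exact ((((h.hasDerivAt_flux ht').const_mul (m + 1)).sub (((hdpow t ht0).mul
      ((h.hasDerivAt_fst t ht').rpow_const (Or.inl (h.pos t ht').ne'))).const_mul μ)).add
      ((hdpow t ht0).const_mul (μ * e))).neg
  have hBmono := le_of_hasDerivAt_nonneg hστ
    (fun x hx => (hdB x hx).continuousAt.continuousWithinAt)
    (fun x hx => hdB x (Ioo_subset_Icc_self hx))
    (fun t ht => by
      have htI := Ioo_subset_Icc_self ht
      have ht0 : 0 < t := by linarith [ht.1]
      have hwpos := h.pos t (hmemτ t htI)
      have h1 := hslope t htI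
      have hq := Real.rpow_pos_of_pos ht0 (m + 1)
      have hwq := Real.rpow_pos_of_pos hwpos (p - 1)
      have hwp : w t ^ p = w t ^ (p - 1) * w t := by
        rw [← Real.rpow_add_one hwpos.ne']
        ring_nf
      have h2 : (c / 2) ^ P ≤ w t ^ p := by
        calc (c / 2) ^ P ≤ (c / 2) ^ p :=
              Real.rpow_le_rpow_of_exponent_ge (by positivity) (by linarith) hpP
          _ ≤ w t ^ p := Real.rpow_le_rpow (by positivity) (hhalf t htI) (by linarith)
      have h3 : e * (m + 2) = (c / 2) ^ P / 2 := by
        rw [he]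
        field_simp
      rw [← hpw t ht0]
      have h4 : w t ^ (p - 1) * (p * (t * -z t)) ≤ w t ^ p / 2 := by
        rw [hwp, mul_div_assoc]
        gcongr
      have h5 : 0 ≤ μ * t ^ (m + 1) *
          (w t ^ p - w t ^ (p - 1) * (p * (t * -z t)) - e * (m + 2)) := by
        apply mul_nonneg (by positivity)
        rw [h3]
        linarith
      refine h5.trans (le_of_eq ?_)
      ring)
  have hBτ : 0 < B τ := by
    have h1 := h.convex τ (hmemτ τ ⟨hστ, le_rfl⟩)
    have hτ0 : 0 < τ := by linarith
    have h2 : B τ = τ ^ (m + 2) * (-(m + 1) * (z τ / τ) - μ * w τ ^ p) := by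
      simp only [hB]
      rw [← hpw τ hτ0]
      field_simp
    rw [h2]
    positivity
  have hBσ : B σ ≤ (m + 1) * (a + κ * σ ^ (m + 2) / (m + 2)) := by
    have hσ0 : 0 < σ := by linarith
    have hσm := hmemτ σ ⟨le_rfl, hστ⟩
    have h1 := hG σ hσm
    have h2 := h.pos σ hσm
    have h3 : 0 ≤ μ * (σ ^ (m + 2) * (w σ) ^ p) := by positivity
    have h4 : μ * σ ^ (m + 2) / (m + 2) ≤ κ * σ ^ (m + 2) / (m + 2) := by gcongr
    have h5 : (m + 1) * -(σ ^ (m + 1) * z σ) ≤ (m + 1) * (a + κ * σ ^ (m + 2) / (m + 2)) := by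
      gcongr
      linarith
    simp only [hB]
    linarith
  have hfin := hT0' τ hτT0
  have hτp : μ * τ ^ (m + 2) = κ * τ ^ m := by
    have hτ0 : 0 < τ := by linarith
    rw [← hpw τ hτ0, hpw' τ hτ0, ← hτ2]
    ring
  have h8 : μ * e * σ ^ (m + 2) ≤ κ * e * σ ^ (m + 2) := by
    have hσ0 : 0 < σ := by linarith
    gcongr
  have h9 : μ * e * τ ^ (m + 2) = e * (κ * τ ^ m) := by
    rw [← hτp]
    ring
  linarith

/-- If `t² w^{p-1}` is small and the logarithmic slope exceeds `a` at the start, then the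
logarithmic slope stays above `a` up to the zero of `w`. -/
lemma exists_forall_le_slope_of_isEmdenSol {m a P : ℝ} (hm : 0 < m) (ha : 0 < a) (ham : a < m)
    (hP : 1 ≤ P) : ∃ δ > 0, ∀ (p μ s T : ℝ) (w z : ℝ → ℝ), 1 < p → p ≤ P → 2 ≤ a * (p - 1) →
      IsEmdenSol m μ p s T w z → a * w s < -(s * z s) → μ * (s ^ 2 * w s ^ (p - 1)) < δ →
      ∀ t ∈ Ico s T, a * w t ≤ -(t * z t) := by
  obtain ⟨δ, hδ, H⟩ := exists_le_coeff_of_isEmdenSol hm ha ham hP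
  refine ⟨δ, hδ, ?_⟩
  intro p μ s T w z hp hpP hap h hs hsmall t ht
  by_contra! hlt
  have hsub : Icc s t ⊆ Ico s T := fun x hx => ⟨hx.1, hx.2.trans_lt ht.2⟩
  have hwc : ContinuousOn w (Icc s t) :=
    h.continuousOn.mono (hsub.trans Ico_subset_Icc_self)
  have hzc : ContinuousOn z (Icc s t) := h.continuousOn_snd.mono hsub
  set S := {x ∈ Icc s t | -(x * z x) ≤ a * w x} with hS
  have hclosed : IsClosed S :=
    isClosed_Icc.isClosed_le (continuousOn_id.mul hzc).neg (continuousOn_const.mul hwc)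
  have hcomp : IsCompact S := isCompact_Icc.of_isClosed_subset hclosed (fun x hx => hx.1)
  have hne : S.Nonempty := ⟨t, ⟨ht.1, le_rfl⟩, hlt.le⟩
  have hmem := hcomp.sInf_mem hne
  set r := sInf S with hr
  have hrT := hsub hmem.1
  have hbefore : ∀ x ∈ Ioo s r, a * w x < -(x * z x) := by
    intro x hx
    by_contra! hx'
    have : r ≤ x := csInf_le hcomp.bddBelow ⟨⟨hx.1.le, hx.2.le.trans hmem.1.2⟩, hx'⟩
    linarith [hx.2]
  have hsr : s ≤ r := hmem.1.1
  have hmono := le_of_hasDerivAt_nonneg (f := fun x => -(x ^ 2 * w x ^ (p - 1)))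
    (f' := fun x => -(2 * x * w x ^ (p - 1) + x ^ 2 * (z x * (p - 1) * w x ^ (p - 1 - 1)))) hsr
    (by
      refine ((continuousOn_id.pow 2).mul (ContinuousOn.rpow_const
        (hwc.mono (Icc_subset_Icc_right hmem.1.2)) ?_)).neg
      intro x hx
      exact Or.inl (h.pos x ⟨hx.1, hx.2.trans_lt hrT.2⟩).ne')
    (fun x hx => by
      have hx' : x ∈ Ico s T := ⟨hx.1.le, hx.2.trans hrT.2⟩
      have d1 : HasDerivAt (fun x : ℝ => x ^ 2) (2 * x) x := by
        simpa using hasDerivAt_pow 2 x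
      exact (d1.mul ((h.hasDerivAt_fst x hx').rpow_const (Or.inl (h.pos x hx').ne'))).neg)
    (fun x hx => by
      have hx' : x ∈ Ico s T := ⟨hx.1.le, hx.2.trans hrT.2⟩
      have hw := h.pos x hx'
      have hx0 : 0 < x := h.start_pos.trans hx.1
      have h1 : w x ^ (p - 1) = w x ^ (p - 1 - 1) * w x := by
        rw [← Real.rpow_add_one hw.ne']
        ring_nf
      have h2 := Real.rpow_pos_of_pos hw (p - 1 - 1)
      have h3 := hbefore x hx
      have h4 : 0 ≤ (p - 1) * (-(x * z x)) - 2 * w x := by nlinarith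
      rw [h1]
      have h5 : 0 ≤ x * w x ^ (p - 1 - 1) * ((p - 1) * (-(x * z x)) - 2 * w x) := by positivity
      refine h5.trans (le_of_eq ?_)
      ring)
  have h' := h.mono hsr
  have hr0 := h'.start_pos
  have hwr := h.pos r hrT
  have hcoef := H p _ (T / r) _ _ hp hpP ((one_lt_div hr0).2 hrT.2) (h'.rescale hrT.2)
    (by simp [hwr.ne'])
    (by
      have := hmem.2
      rw [mul_one, ← neg_div, div_le_iff₀ hwr]
      exact this)
  have : μ * (r ^ 2 * w r ^ (p - 1)) ≤ μ * (s ^ 2 * w s ^ (p - 1)) :=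
    mul_le_mul_of_nonneg_left (neg_le_neg_iff.1 hmono) h.coeff_pos.le
  linarith

namespace IsEmdenSol

variable {m μ p s T : ℝ} {w z : ℝ → ℝ}

lemma mul_rpow_le_of_slope (h : IsEmdenSol m μ p s T w z) {a : ℝ}
    (hslope : ∀ t ∈ Ico s T, a * w t ≤ -(t * z t)) {t : ℝ} (ht : t ∈ Ico s T) :
    w t * t ^ a ≤ w s * s ^ a := by
  have hmem : ∀ x ∈ Icc s t, x ∈ Ico s T := fun x hx => ⟨hx.1, hx.2.trans_lt ht.2⟩
  have hd : ∀ x ∈ Icc s t, HasDerivAt (fun x => -(w x * x ^ a))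
      (-(z x * x ^ a + w x * (a * x ^ (a - 1)))) x := fun x hx => by
    have hx0 : 0 < x := h.start_pos.trans_le hx.1
    exact ((h.hasDerivAt_fst x (hmem x hx)).mul
      (Real.hasDerivAt_rpow_const (Or.inl hx0.ne'))).neg
  have := le_of_hasDerivAt_nonneg ht.1
    (fun x hx => (hd x hx).continuousAt.continuousWithinAt)
    (fun x hx => hd x (Ioo_subset_Icc_self hx))
    (fun x hx => by
      have hx' := hmem x (Ioo_subset_Icc_self hx)
      have hx0 : 0 < x := h.start_pos.trans_le hx'.1
      have h1 := hslope x hx'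
      have h2 := Real.rpow_pos_of_pos hx0 (a - 1)
      have h3 : x ^ a = x ^ (a - 1) * x := by
        rw [← Real.rpow_add_one hx0.ne']
        ring_nf
      rw [h3]
      have h4 : 0 ≤ x ^ (a - 1) * (-(x * z x) - a * w x) := by
        apply mul_nonneg h2.le
        linarith
      refine h4.trans (le_of_eq ?_)
      ring)
  linarith

/-- The flux `-t^{m+1} w'` is almost conserved when `w` decays faster than the critical rate. -/
lemma flux_le_of_slope (h : IsEmdenSol m μ p s T w z) {a γ C P : ℝ} (hs : 1 ≤ s) (hp : 0 < p)
    (hpP : p ≤ P) (hγ : 0 < γ) (hpa : m + 2 + γ ≤ p * a) (hC : 1 ≤ C) (hwC : w s * s ^ a ≤ C)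
    (hslope : ∀ t ∈ Ico s T, a * w t ≤ -(t * z t)) {t : ℝ} (ht : t ∈ Ico s T) :
    -(t ^ (m + 1) * z t) ≤ -(s ^ (m + 1) * z s) + μ * C ^ P / γ * s ^ (-γ) := by
  have hmem : ∀ x ∈ Icc s t, x ∈ Ico s T := fun x hx => ⟨hx.1, hx.2.trans_lt ht.2⟩
  have hd : ∀ x ∈ Icc s t, HasDerivAt
      (fun x => -(-(x ^ (m + 1) * z x)) - μ * C ^ P / γ * x ^ (-γ))
      (-(μ * (x ^ (m + 1) * (w x) ^ p)) - μ * C ^ P / γ * (-γ * x ^ (-γ - 1))) x := fun x hx => by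
    have hx0 : 0 < x := h.start_pos.trans_le hx.1
    exact (h.hasDerivAt_flux (hmem x hx)).neg.sub
      ((Real.hasDerivAt_rpow_const (Or.inl hx0.ne')).const_mul _)
  have hfin := le_of_hasDerivAt_nonneg ht.1
    (fun x hx => (hd x hx).continuousAt.continuousWithinAt)
    (fun x hx => hd x (Ioo_subset_Icc_self hx))
    (fun x hx => by
      have hx' := hmem x (Ioo_subset_Icc_self hx)
      have hx1 : 1 ≤ x := hs.trans hx'.1
      have hx0 : 0 < x := by linarith
      have hwx := h.pos x hx'
      have hμ := h.coeff_pos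
      have h1 : w x * x ^ a ≤ C := (h.mul_rpow_le_of_slope hslope hx').trans hwC
      have h2 : (w x * x ^ a) ^ p ≤ C ^ P :=
        (Real.rpow_le_rpow (by positivity) h1 hp.le).trans
          (Real.rpow_le_rpow_of_exponent_le hC hpP)
      rw [Real.mul_rpow hwx.le (by positivity), ← Real.rpow_mul hx0.le] at h2
      have h3 : x ^ (m + 1) * w x ^ p ≤ C ^ P * x ^ (-γ - 1) := by
        have e1 : x ^ (m + 1) = x ^ (a * p) * x ^ (m + 1 - a * p) := by
          rw [← Real.rpow_add hx0]
          ring_nf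
        have e2 : x ^ (m + 1 - a * p) ≤ x ^ (-γ - 1) :=
          Real.rpow_le_rpow_of_exponent_le hx1 (by nlinarith)
        calc x ^ (m + 1) * w x ^ p = (w x ^ p * x ^ (a * p)) * x ^ (m + 1 - a * p) := by
              rw [e1]
              ring
          _ ≤ C ^ P * x ^ (-γ - 1) := by gcongr
      have h4 : 0 ≤ μ * (C ^ P * x ^ (-γ - 1) - x ^ (m + 1) * w x ^ p) := by
        apply mul_nonneg hμ.le
        linarith
      refine h4.trans (le_of_eq ?_)
      field_simp
      ring)
  have : 0 ≤ μ * C ^ P / γ * t ^ (-γ) := by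
    have := h.coeff_pos
    have := h.start_pos.trans_le ht.1
    positivity
  linarith

/-- If the flux is close to `m c` then `w` is close to the multiple of `t^{-m} - T^{-m}` with
flux `m c`. -/
lemma abs_rpow_mul_sub_le (h : IsEmdenSol m μ p s T w z) {c θ : ℝ} (hθ : 0 ≤ θ)
    (hflux : ∀ t ∈ Ico s T, |-(t ^ (m + 1) * z t) - m * c| ≤ m * θ) {t : ℝ} (ht : t ∈ Icc s T) :
    |t ^ m * w t - c * (1 - (T / t) ^ (-m))| ≤ θ := by
  have ht0 : 0 < t := h.start_pos.trans_le ht.1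
  have hT0 : 0 < T := ht0.trans_le ht.2
  have hmem : ∀ x ∈ Ioo t T, x ∈ Ico s T := fun x hx => ⟨ht.1.trans hx.1.le, hx.2⟩
  have hinv : ∀ x : ℝ, 0 < x → x ^ (-m - 1) * x ^ (m + 1) = 1 := fun x hx => by
    rw [← Real.rpow_add hx]
    simp
  have hcont : ∀ A : ℝ, ContinuousOn (fun x => w x - A * x ^ (-m)) (Icc t T) := fun A => by
    refine (h.continuousOn.mono (Icc_subset_Icc_left ht.1)).sub
      (continuousOn_const.mul (ContinuousOn.rpow_const continuousOn_id ?_))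
    exact fun x hx => Or.inl (ht0.trans_le hx.1).ne'
  have hder : ∀ A : ℝ, ∀ x ∈ Ioo t T, HasDerivAt (fun x => w x - A * x ^ (-m))
      (z x - A * (-m * x ^ (-m - 1))) x := fun A x hx =>
    (h.hasDerivAt_fst x (hmem x hx)).sub
      ((Real.hasDerivAt_rpow_const (Or.inl (ht0.trans hx.1).ne')).const_mul A)
  have hid : ∀ A : ℝ, ∀ x ∈ Ioo t T, z x - A * (-m * x ^ (-m - 1)) =
      x ^ (-m - 1) * (m * A - -(x ^ (m + 1) * z x)) := fun A x hx => by
    have := hinv x (ht0.trans hx.1)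
    linear_combination (-z x) * this
  have hup := le_of_hasDerivAt_nonneg ht.2 (hcont (c + θ)) (hder (c + θ)) (fun x hx => by
    rw [hid _ x hx]
    have h1 := (abs_le.1 (hflux x (hmem x hx))).2
    have h2 := Real.rpow_pos_of_pos (ht0.trans hx.1) (-m - 1)
    apply mul_nonneg h2.le
    linarith)
  have hlow := le_of_hasDerivAt_nonneg ht.2 (hcont (c - θ)).neg
    (fun x hx => (hder (c - θ) x hx).neg) (fun x hx => by
    rw [hid _ x hx]
    have h1 := (abs_le.1 (hflux x (hmem x hx))).1
    have h2 := Real.rpow_pos_of_pos (ht0.trans hx.1) (-m - 1)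
    rw [← mul_neg]
    apply mul_nonneg h2.le
    linarith)
  simp only [Pi.neg_apply, h.end_eq_zero] at hup hlow
  have hquot : (T / t) ^ (-m) = t ^ m * T ^ (-m) := by
    rw [Real.div_rpow hT0.le ht0.le, Real.rpow_neg ht0.le, div_inv_eq_mul, mul_comm]
  have hone : t ^ m * t ^ (-m) = 1 := by
    rw [← Real.rpow_add ht0]
    simp
  have htm := Real.rpow_pos_of_pos ht0 m
  have hq0 : 0 ≤ t ^ m * T ^ (-m) := by positivity
  rw [hquot, abs_le]
  have hup' := mul_le_mul_of_nonneg_left hup htm.le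
  have hlow' := mul_le_mul_of_nonneg_left hlow htm.le
  have hθq : 0 ≤ θ * (t ^ m * T ^ (-m)) := by positivity
  constructor
  · have e1 : t ^ m * -(w t - (c - θ) * t ^ (-m)) =
        -(t ^ m * w t) + (c - θ) * (t ^ m * t ^ (-m)) := by ring
    have e2 : t ^ m * -(0 - (c - θ) * T ^ (-m)) = (c - θ) * (t ^ m * T ^ (-m)) := by ring
    rw [e1, e2, hone] at hlow'
    linarith
  · have e1 : t ^ m * (w t - (c + θ) * t ^ (-m)) =
        t ^ m * w t - (c + θ) * (t ^ m * t ^ (-m)) := by ring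
    have e2 : t ^ m * (0 - (c + θ) * T ^ (-m)) = -((c + θ) * (t ^ m * T ^ (-m))) := by ring
    rw [e1, e2, hone] at hup'
    linarith

end IsEmdenSol

/-- Fast decay with convergent flux forces the exponent to be above the Serrin-type exponent. -/
lemma add_two_lt_mul_of_fast_decay {m μ p c L R : ℝ} {U F : ℝ → ℝ} (hp : 0 < p)
    (hμ : 0 < μ) (hc : 0 < c) (hF : ∀ r, R < r → HasDerivAt F (μ * (r ^ (m + 1) * U r ^ p)) r)
    (hU : Tendsto (fun r : ℝ => r ^ m * U r) atTop (nhds c)) (hUpos : ∀ r, 0 ≤ r → 0 < U r)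
    (hL : Tendsto F atTop (nhds L)) : m + 2 < p * m := by
  by_contra! hle
  obtain ⟨R1, hR1⟩ := eventually_atTop.1 ((hU.eventually_const_lt (half_lt_self hc)).and
    ((eventually_ge_atTop 1).and (eventually_gt_atTop R)))
  set K := μ * (c / 2) ^ p with hK
  have hK0 : 0 < K := by positivity
  have hR10 : 1 ≤ R1 := (hR1 R1 le_rfl).2.1
  have hbound : ∀ r, R1 ≤ r → F R1 - K * Real.log R1 + K * Real.log r ≤ F r := by
    intro r hr
    have hd : ∀ x ∈ Icc R1 r, HasDerivAt (fun x => F x - K * Real.log x)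
        (μ * (x ^ (m + 1) * U x ^ p) - K * x⁻¹) x := fun x hx => by
      have hx0 : 0 < x := by linarith [hx.1]
      exact (hF x (hR1 x hx.1).2.2).sub ((Real.hasDerivAt_log hx0.ne').const_mul K)
    have := le_of_hasDerivAt_nonneg hr
      (fun x hx => (hd x hx).continuousAt.continuousWithinAt)
      (fun x hx => hd x (Ioo_subset_Icc_self hx))
      (fun x hx => by
        obtain ⟨h1, h2, -⟩ := hR1 x hx.1.le
        have hx0 : 0 < x := by linarith
        have hUx := hUpos x hx0.le
        have h3 : (c / 2) ^ p ≤ (x ^ m * U x) ^ p := Real.rpow_le_rpow (by positivity) h1.le hp.le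
        rw [Real.mul_rpow (by positivity) hUx.le, ← Real.rpow_mul hx0.le] at h3
        have h4 : x ^ (-1 : ℝ) * x ^ (m * p) ≤ x ^ (m + 1) := by
          rw [← Real.rpow_add hx0]
          exact Real.rpow_le_rpow_of_exponent_le h2 (by linarith)
        have h5 : K * x⁻¹ ≤ μ * (x ^ (m + 1) * U x ^ p) := by
          rw [← Real.rpow_neg_one]
          calc K * x ^ (-1 : ℝ) = μ * (x ^ (-1 : ℝ) * (c / 2) ^ p) := by
                rw [hK]
                ring
            _ ≤ μ * (x ^ (-1 : ℝ) * (x ^ (m * p) * U x ^ p)) := by gcongr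
            _ = μ * ((x ^ (-1 : ℝ) * x ^ (m * p)) * U x ^ p) := by ring
            _ ≤ _ := by gcongr
        linarith)
    linarith
  have hlog : Tendsto (fun r => F R1 - K * Real.log R1 + K * Real.log r) atTop atTop :=
    tendsto_atTop_add_const_left _ _ (Real.tendsto_log_atTop.const_mul_atTop hK0)
  exact not_tendsto_nhds_of_tendsto_atTop
    (tendsto_atTop_mono' _ (eventually_atTop.2 ⟨R1, hbound⟩) hlog) L hL

lemma IsRadialSol.isEmdenSol {lam Lam k p ρ m R : ℝ} {u v : ℝ → ℝ}
    (h : IsRadialSol lam Lam k p ρ u v) (hlam : 0 < lam) (hlL : lam ≤ Lam)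
    (hm : m + 1 = lam / Lam * k) (hR : 0 < R) (hcont : ContinuousOn u (Icc 0 ρ)) (hρ : u ρ = 0)
    (hconv : ∀ r ∈ Ico R ρ, 0 < pucciInv lam Lam (-(u r) ^ p - lam * k * (v r / r))) :
    IsEmdenSol m (1 / Lam) p R ρ u v := by
  have hLam : 0 < Lam := hlam.trans_le hlL
  have heq : ∀ r ∈ Ico R ρ, pucciInv lam Lam (-(u r) ^ p - lam * k * (v r / r)) =
      -(m + 1) * (v r / r) - 1 / Lam * (u r) ^ p := fun r hr => by
    rw [pucciInv_eq_of_pos hlam hlL (hconv r hr), hm]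
    ring
  have hI : ∀ r ∈ Ico R ρ, r ∈ Ioo 0 ρ := fun r hr => ⟨hR.trans_le hr.1, hr.2⟩
  exact
    { start_pos := hR
      coeff_pos := by positivity
      continuousOn := hcont.mono (Icc_subset_Icc_left hR.le)
      end_eq_zero := hρ
      pos := fun t ht => h.pos t (Ioo_subset_Ico_self (hI t ht))
      nonpos := fun t ht => h.nonpos t (Ioo_subset_Ico_self (hI t ht))
      hasDerivAt_fst := fun t ht => h.hasDerivAt_fst t (hI t ht)
      hasDerivAt_snd := fun t ht => heq t ht ▸ h.hasDerivAt_snd t (hI t ht)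
      convex := fun t ht => heq t ht ▸ hconv t ht }

/-- Solutions with nearby exponents converge to the entire solution at a fixed radius. -/
lemma tendsto_of_isRadialSol {lam Lam k pstar R : ℝ} {U V : ℝ → ℝ} (hlam : 0 < lam)
    (hlL : lam ≤ Lam) (hk : 0 ≤ k) (hU : ∀ ρ, 0 < ρ → IsRadialSol lam Lam k pstar ρ U V)
    {p ρ : ℕ → ℝ} {w z : ℕ → ℝ → ℝ} (hp : ∀ n, 1 < p n) (hpp : ∀ n, p n ≤ pstar)
    (hplim : Tendsto p atTop (nhds pstar)) (hρ : Tendsto ρ atTop atTop)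
    (hw : ∀ n, IsRadialSol lam Lam k (p n) (ρ n) (w n) (z n)) (hR : 0 < R) :
    Tendsto (fun n => w n R) atTop (nhds (U R)) ∧
      Tendsto (fun n => z n R) atTop (nhds (V R)) := by
  set b : ℕ → ℝ := fun n => √((pstar - p n) ^ 2 / lam * R *
    Real.exp ((1 + (pstar + 1) / lam) * R)) with hb
  have hb0 : Tendsto b atTop (nhds 0) := by
    have : Tendsto b atTop (nhds √((pstar - pstar) ^ 2 / lam * R *
      Real.exp ((1 + (pstar + 1) / lam) * R))) :=
      (((((hplim.const_sub pstar).pow 2).div_const lam).mul_const R).mul_const _).sqrt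
    simpa using this
  have hle : ∀ᶠ n in atTop, (w n R - U R) ^ 2 + (z n R - V R) ^ 2 ≤
      (pstar - p n) ^ 2 / lam * R * Real.exp ((1 + (pstar + 1) / lam) * R) := by
    filter_upwards [hρ.eventually_gt_atTop R] with n hn
    exact (hw n).sq_dist_le hlam hlL hk (hp n) (hpp n) (hU (R + 1) (by linarith)) hR.le hn
      (by linarith)
  constructor
  · rw [tendsto_iff_norm_sub_tendsto_zero]
    refine squeeze_zero' (Eventually.of_forall fun n => norm_nonneg _) ?_ hb0
    filter_upwards [hle] with n hn
    rw [Real.norm_eq_abs]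
    apply Real.abs_le_sqrt
    linarith [sq_nonneg (z n R - V R)]
  · rw [tendsto_iff_norm_sub_tendsto_zero]
    refine squeeze_zero' (Eventually.of_forall fun n => norm_nonneg _) ?_ hb0
    filter_upwards [hle] with n hn
    rw [Real.norm_eq_abs]
    apply Real.abs_le_sqrt
    linarith [sq_nonneg (w n R - U R)]

/-- Asymptotics of normalized solutions of almost critical problems on growing balls, along radii
tending to infinity. -/
lemma tendsto_rpow_mul_sub_of_isRadialSol {lam Lam k m pstar c R0 : ℝ} {U V : ℝ → ℝ}
    (hlam : 0 < lam) (hlL : lam ≤ Lam) (hk : 0 ≤ k) (hm : 0 < m) (hmk : m + 1 = lam / Lam * k)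
    (hpstar : 1 < pstar) (hc : 0 < c) (hR0 : 0 < R0)
    (hU : ∀ ρ, 0 < ρ → IsRadialSol lam Lam k pstar ρ U V)
    (hconv : ∀ r, R0 < r → 0 < pucciInv lam Lam (-(U r) ^ pstar - lam * k * (V r / r)))
    (hUlim : Tendsto (fun r : ℝ => r ^ m * U r) atTop (nhds c))
    (hVlim : Tendsto (fun r : ℝ => r ^ (m + 1) * V r) atTop (nhds (-m * c)))
    {p ρ rr : ℕ → ℝ} {w z : ℕ → ℝ → ℝ} (hp : ∀ n, 1 < p n) (hpp : ∀ n, p n ≤ pstar)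
    (hplim : Tendsto p atTop (nhds pstar))
    (hw : ∀ n, IsRadialSol lam Lam k (p n) (ρ n) (w n) (z n))
    (hwc : ∀ n, ContinuousOn (w n) (Icc 0 (ρ n))) (hwρ : ∀ n, w n (ρ n) = 0)
    (hwconv : ∀ n, ∀ R ∈ Ioo 0 (ρ n),
      0 < pucciInv lam Lam (-(w n R) ^ p n - lam * k * (z n R / R)) →
      ∀ r ∈ Ico R (ρ n), 0 < pucciInv lam Lam (-(w n r) ^ p n - lam * k * (z n r / r)))
    (hrr : Tendsto rr atTop atTop) (hrrρ : ∀ n, rr n ≤ ρ n) :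
    Tendsto (fun n => rr n ^ m * w n (rr n) - c * (1 - (ρ n / rr n) ^ (-m))) atTop (nhds 0) := by
  have hLam : 0 < Lam := hlam.trans_le hlL
  have hρ : Tendsto ρ atTop atTop := tendsto_atTop_mono hrrρ hrr
  have hUpos : ∀ r, 0 ≤ r → 0 < U r := fun r hr =>
    (hU (r + 1) (by linarith)).pos r ⟨hr, by linarith⟩
  have hFlim : Tendsto (fun r : ℝ => -(r ^ (m + 1) * V r)) atTop (nhds (m * c)) := by
    simpa using hVlim.neg
  have hcrit : m + 2 < pstar * m := by
    refine add_two_lt_mul_of_fast_decay (μ := 1 / Lam) (R := R0) (by linarith) (by positivity) hc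
      (fun r hr => ?_) hUlim hUpos hFlim
    have hr0 : 0 < r := hR0.trans hr
    have hd := (hU (r + 1) (by linarith)).hasDerivAt_snd r ⟨hr0, by linarith⟩
    rw [pucciInv_eq_of_pos hlam hlL (hconv r hr)] at hd
    have d1 : HasDerivAt (fun t : ℝ => t ^ (m + 1)) ((m + 1) * r ^ m) r := by
      simpa using Real.hasDerivAt_rpow_const (p := m + 1) (Or.inl hr0.ne')
    refine (d1.mul hd).neg.congr_deriv ?_
    rw [Real.rpow_add_one hr0.ne', hmk]
    field_simp
    ring
  obtain ⟨a, ha0, ham, hpa⟩ : ∃ a, 0 < a ∧ a < m ∧ m + 2 < pstar * a := by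
    have h1 : (m + 2) / pstar < m := by
      rw [div_lt_iff₀ (by linarith)]
      linarith
    obtain ⟨a, h2, h3⟩ := exists_between h1
    refine ⟨a, lt_trans (by positivity) h2, h3, ?_⟩
    rw [div_lt_iff₀ (by linarith)] at h2
    linarith
  obtain ⟨γ, hγ, hγa⟩ : ∃ γ, 0 < γ ∧ m + 2 + γ < pstar * a :=
    ⟨(pstar * a - (m + 2)) / 2, by linarith, by linarith⟩
  obtain ⟨δ, hδ, Hslope⟩ := exists_forall_le_slope_of_isEmdenSol hm ha0 ham hpstar.le
  rw [Metric.tendsto_nhds]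
  intro θ hθ
  set C := c + 2 with hC
  set η := m * (θ / 2) / 4 with hη
  have hη0 : 0 < η := by positivity
  have e3 : ∀ᶠ R : ℝ in atTop, |-(R ^ (m + 1) * V R) - m * c| < η := by
    have := (Metric.tendsto_nhds.1 hFlim) η hη0
    simpa [Real.dist_eq] using this
  have e4 : ∀ᶠ R : ℝ in atTop, 1 / Lam * C ^ pstar / γ * R ^ (-γ) < η := by
    have : Tendsto (fun R : ℝ => 1 / Lam * C ^ pstar / γ * R ^ (-γ)) atTop (nhds _) :=
      (tendsto_rpow_neg_atTop hγ).const_mul _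
    rw [mul_zero] at this
    exact this.eventually_lt_const hη0
  have e5 : ∀ᶠ R : ℝ in atTop, a * U R < -(R * V R) := by
    have h1 : Tendsto (fun R : ℝ => -(R ^ (m + 1) * V R) - a * (R ^ m * U R)) atTop
      (nhds (m * c - a * c)) := hFlim.sub (hUlim.const_mul a)
    have h2 : 0 < m * c - a * c := by nlinarith
    filter_upwards [h1.eventually_const_lt h2, eventually_gt_atTop 0] with R hR hR0
    rw [Real.rpow_add_one hR0.ne'] at hR
    have h3 := Real.rpow_pos_of_pos hR0 m
    have h4 : 0 < R ^ m * (-(R * V R) - a * U R) := by linarith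
    linarith [(mul_pos_iff_of_pos_left h3).1 h4]
  have e6 : ∀ᶠ R : ℝ in atTop, 1 / Lam * (R ^ 2 * U R ^ (pstar - 1)) < δ := by
    have h0 : 0 < m * (pstar - 1) - 2 := by linarith
    have h1 : Tendsto (fun R : ℝ => 1 / Lam * (R ^ (-(m * (pstar - 1) - 2)) *
      (R ^ m * U R) ^ (pstar - 1))) atTop (nhds (1 / Lam * (0 * c ^ (pstar - 1)))) :=
      ((tendsto_rpow_neg_atTop h0).mul (hUlim.rpow_const (Or.inl hc.ne'))).const_mul _
    rw [zero_mul, mul_zero] at h1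
    filter_upwards [h1.eventually_lt_const hδ, eventually_gt_atTop 0] with R hR hR0
    refine lt_of_eq_of_lt ?_ hR
    rw [Real.mul_rpow (by positivity) (hUpos R hR0.le).le, ← Real.rpow_mul hR0.le, ← mul_assoc
      (R ^ (-(m * (pstar - 1) - 2))), ← Real.rpow_add hR0, ← Real.rpow_natCast R 2]
    congr 3
    push_cast
    ring_nf
  have e7 : ∀ᶠ R : ℝ in atTop, U R * R ^ a < c + 1 := by
    filter_upwards [hUlim.eventually_lt_const (lt_add_one c), eventually_ge_atTop 1] with R hR hR1
    have h1 : R ^ a ≤ R ^ m := Real.rpow_le_rpow_of_exponent_le hR1 ham.le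
    have h2 := hUpos R (by linarith)
    nlinarith
  obtain ⟨R, hRR0, hR1, hR3, hR4, hR5, hR6, hR7⟩ := ((eventually_gt_atTop R0).and
    ((eventually_ge_atTop 1).and (e3.and (e4.and (e5.and (e6.and e7)))))).exists
  have hRpos : 0 < R := by linarith
  obtain ⟨hwlim, hzlim⟩ := tendsto_of_isRadialSol hlam hlL hk hU hp hpp hplim hρ hw hRpos
  have hUR : U R ≠ 0 := (hUpos R hRpos.le).ne'
  have f1 : ∀ᶠ n in atTop, 0 < pucciInv lam Lam (-(w n R) ^ p n - lam * k * (z n R / R)) := by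
    have h1 : Tendsto (fun n => pucciInv lam Lam (-(w n R) ^ p n - lam * k * (z n R / R))) atTop
        (nhds (pucciInv lam Lam (-(U R) ^ pstar - lam * k * (V R / R)))) :=
      ((continuous_pucciInv lam Lam).tendsto _).comp
        ((hwlim.rpow hplim (Or.inl hUR)).neg.sub ((hzlim.div_const R).const_mul _))
    exact h1.eventually_const_lt (hconv R hRR0)
  have f3 : ∀ᶠ n in atTop, |-(R ^ (m + 1) * z n R) - m * c| < η :=
    (((hzlim.const_mul _).neg.sub_const (m * c)).abs).eventually_lt_const hR3
  have f5 : ∀ᶠ n in atTop, a * w n R < -(R * z n R) :=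
    (hwlim.const_mul a).eventually_lt (hzlim.const_mul R).neg hR5
  have f6 : ∀ᶠ n in atTop, 1 / Lam * (R ^ 2 * w n R ^ (p n - 1)) < δ :=
    (((hwlim.rpow (hplim.sub_const 1) (Or.inl hUR)).const_mul _).const_mul _).eventually_lt_const
      hR6
  have f7 : ∀ᶠ n in atTop, w n R * R ^ a < C :=
    (hwlim.mul_const _).eventually_lt_const (by linarith)
  have f8 : ∀ᶠ n in atTop, m + 2 + γ < p n * a :=
    (hplim.mul_const a).eventually_const_lt hγa
  filter_upwards [f1, f3, f5, f6, f7, f8, hrr.eventually_gt_atTop R] with n g1 g3 g5 g6 g7 g8 g9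
  have hRρ : R < ρ n := g9.trans_le (hrrρ n)
  have hem : IsEmdenSol m (1 / Lam) (p n) R (ρ n) (w n) (z n) :=
    (hw n).isEmdenSol hlam hlL hmk hRpos (hwc n) (hwρ n) (hwconv n R ⟨hRpos, hRρ⟩ g1)
  have hslope := Hslope (p n) _ R (ρ n) (w n) (z n) (hp n) (hpp n) (by nlinarith) hem g5 g6
  have hfin := hem.abs_rpow_mul_sub_le (c := c) (θ := θ / 2) (by positivity) (fun t ht => by
    have h1 := hem.flux_le_of_slope hR1 (by linarith [hp n]) (hpp n) hγ g8.le (by linarith)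
      g7.le hslope ht
    have h2 := hem.flux_mono le_rfl ht.1 ht.2
    have h3 := abs_lt.1 g3
    rw [abs_le]
    have h4 : m * (θ / 2) = 4 * η := by
      rw [hη]
      ring
    rw [h4]
    constructor <;> linarith [h3.1, h3.2]) ⟨g9.le, hrrρ n⟩
  rw [Real.dist_eq, sub_zero]
  linarith

lemma hasDerivAt_of_contDiffOn_two {u : ℝ → ℝ} {s : Set ℝ} (hs : IsOpen s)
    (h : ContDiffOn ℝ 2 u s) {x : ℝ} (hx : x ∈ s) :
    HasDerivAt u (deriv u x) x ∧ HasDerivAt (deriv u) (deriv (deriv u) x) x := by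
  have h1 : ContDiffOn ℝ 1 (deriv u) s := h.deriv_of_isOpen hs (by norm_num)
  have hsx := hs.mem_nhds hx
  exact ⟨((h.contDiffAt hsx).differentiableAt (by norm_num)).hasDerivAt,
    ((h1.contDiffAt hsx).differentiableAt (by norm_num)).hasDerivAt⟩

/-- The radial Pucci equation solved for the second derivative. -/
lemma deriv_deriv_eq_pucciInv {lam Lam q r : ℝ} {N : ℕ} {u : ℝ → ℝ} (hlam : 0 < lam)
    (hlL : lam ≤ Lam) (hr : 0 < r) (hu : deriv u r ≤ 0)
    (h : -radialPucci lam Lam N u r = u r ^ q) :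
    deriv (deriv u) r =
      pucciInv lam Lam (-(u r) ^ q - lam * ((N : ℝ) - 1) * (deriv u r / r)) := by
  apply eq_pucciInv hlam hlL
  have h1 : deriv u r / r ≤ 0 := div_nonpos_of_nonpos_of_nonneg hu hr.le
  unfold radialPucci at h
  rw [max_eq_right h1, min_eq_left h1] at h
  linarith

lemma IsEntireSol.isRadialSol {lam Lam Ntil pstar c1 R0 : ℝ} {N : ℕ} {U : ℝ → ℝ}
    (hlam : 0 < lam) (hlL : lam ≤ Lam) (h : IsEntireSol lam Lam N Ntil pstar c1 R0 U) {ρ : ℝ} :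
    IsRadialSol lam Lam ((N : ℝ) - 1) pstar ρ U (deriv U) := by
  obtain ⟨hC, hpos, h0, h0', hneg, heq, hR0, hcc, -⟩ := h
  have hd : ∀ r : ℝ, 0 < r → _ := fun r hr =>
    hasDerivAt_of_contDiffOn_two isOpen_Ioi (hC.mono Ioi_subset_Ici_self) (mem_Ioi.2 hr)
  have hnonpos : ∀ r, 0 ≤ r → deriv U r ≤ 0 := fun r hr => by
    rcases hr.eq_or_lt with rfl | hr
    · exact h0'.le
    · exact (hneg r hr).le
  exact
    { continuousOn_fst := hC.continuousOn.mono (fun x hx => hx.1)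
      continuousOn_snd := by
        intro r hr
        rcases hr.1.eq_or_lt with h | hr'
        · rw [← h]
          exact (differentiableAt_of_deriv_ne_zero
            (hcc 0 ⟨le_rfl, hR0⟩).ne).continuousAt.continuousWithinAt
        · exact (hd r hr').2.continuousAt.continuousWithinAt
      fst_zero := h0
      snd_zero := h0'
      pos := fun r hr => hpos r hr.1
      nonpos := fun r hr => hnonpos r hr.1
      hasDerivAt_fst := fun r hr => (hd r hr.1).1
      hasDerivAt_snd := fun r hr =>
        deriv_deriv_eq_pucciInv hlam hlL hr.1 (hnonpos r hr.1.le) (heq r hr.1) ▸ (hd r hr.1).2 }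

lemma pucciInv_mul {lam Lam y a : ℝ} (ha : 0 ≤ a) :
    pucciInv lam Lam (a * y) = a * pucciInv lam Lam y := by
  unfold pucciInv
  rw [mul_min_of_nonneg _ _ ha, mul_div_assoc, mul_div_assoc]

/-- The right-hand side of the radial equation under the natural rescaling. -/
lemma pucciInv_rescale {lam Lam k q M ρ x y v : ℝ} (hM : 0 < M) (hρ : ρ = M ^ ((q - 1) / 2))
    (hx : 0 < x) (hy : 0 ≤ y) :
    pucciInv lam Lam (-(M⁻¹ * y) ^ q - lam * k * (M⁻¹ * ρ⁻¹ * v / x)) =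
      M⁻¹ * ρ⁻¹ * ρ⁻¹ * pucciInv lam Lam (-y ^ q - lam * k * (v / (x / ρ))) := by
  have hρ0 : 0 < ρ := hρ ▸ Real.rpow_pos_of_pos hM _
  have hρρ : M⁻¹ * ρ⁻¹ * ρ⁻¹ = M⁻¹ ^ q := by
    have h1 : ρ * ρ * M = M ^ q := by
      rw [hρ, ← Real.rpow_add hM, ← Real.rpow_add_one hM.ne']
      ring_nf
    rw [Real.inv_rpow hM.le, ← h1]
    field_simp
  rw [← pucciInv_mul (by positivity)]
  congr 1
  rw [Real.mul_rpow (by positivity) hy, ← hρρ]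
  field_simp

lemma IsDirichletSol.isRadialSol {lam Lam q r0 : ℝ} {N : ℕ} {u : ℝ → ℝ} (hlam : 0 < lam)
    (hlL : lam ≤ Lam) (h : IsDirichletSol lam Lam N q u) (hr0 : InflectionAt u r0) {ρ : ℝ}
    (hρ : ρ = u 0 ^ ((q - 1) / 2)) :
    IsRadialSol lam Lam ((N : ℝ) - 1) q ρ (fun r => (u 0)⁻¹ * u (r / ρ))
      (fun r => (u 0)⁻¹ * ρ⁻¹ * deriv u (r / ρ)) := by
  obtain ⟨hC, hpos, h1, h0', hnonpos, heq⟩ := h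
  obtain ⟨hr01, hcc, -⟩ := hr0
  have hM : 0 < u 0 := hpos 0 ⟨le_rfl, one_pos⟩
  have hρ0 : 0 < ρ := hρ ▸ Real.rpow_pos_of_pos hM _
  have hd : ∀ r ∈ Ioo (0 : ℝ) 1, _ := fun r hr =>
    hasDerivAt_of_contDiffOn_two isOpen_Ioo (hC.mono Ioo_subset_Icc_self) hr
  have hIco : MapsTo (fun r => r / ρ) (Ico 0 ρ) (Ico 0 1) := fun r hr =>
    ⟨div_nonneg hr.1 hρ0.le, (div_lt_one hρ0).2 hr.2⟩
  have hIoo : ∀ r ∈ Ioo 0 ρ, r / ρ ∈ Ioo (0 : ℝ) 1 := fun r hr =>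
    ⟨div_pos hr.1 hρ0, (div_lt_one hρ0).2 hr.2⟩
  have hdiv : ∀ r, HasDerivAt (fun r => r / ρ) ρ⁻¹ r := fun r => by
    simpa using (hasDerivAt_id r).div_const ρ
  have hcd : ContinuousOn (deriv u) (Ico 0 1) := by
    intro r hr
    rcases hr.1.eq_or_lt with h | hr'
    · rw [← h]
      exact (differentiableAt_of_deriv_ne_zero
        (hcc 0 ⟨le_rfl, hr01.1⟩).ne).continuousAt.continuousWithinAt
    · exact (hd r ⟨hr', hr.2⟩).2.continuousAt.continuousWithinAt
  exact
    { continuousOn_fst := continuousOn_const.mul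
        ((hC.continuousOn.mono Ico_subset_Icc_self).comp (by fun_prop) hIco)
      continuousOn_snd := continuousOn_const.mul (hcd.comp (by fun_prop) hIco)
      fst_zero := by simp [hM.ne']
      snd_zero := by simp [h0']
      pos := fun r hr => by
        have := hpos _ (hIco hr)
        positivity
      nonpos := fun r hr => by
        have := hnonpos _ (Ico_subset_Icc_self (hIco hr))
        exact mul_nonpos_of_nonneg_of_nonpos (by positivity) this
      hasDerivAt_fst := fun r hr => by
        refine (((hd _ (hIoo r hr)).1.comp r (hdiv r)).const_mul (u 0)⁻¹).congr_deriv ?_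
        ring
      hasDerivAt_snd := fun r hr => by
        have hx := hIoo r hr
        refine (((hd _ hx).2.comp r (hdiv r)).const_mul ((u 0)⁻¹ * ρ⁻¹)).congr_deriv ?_
        rw [pucciInv_rescale hM hρ hr.1 (hpos _ ⟨hx.1.le, hx.2⟩).le,
          deriv_deriv_eq_pucciInv hlam hlL hx.1 (hnonpos _ (Ioo_subset_Icc_self hx)) (heq _ hx)]
        ring }

/-- Once a rescaled Dirichlet solution with a single inflection radius is convex, it stays so. -/
lemma IsDirichletSol.convex_of_le {lam Lam q r0 : ℝ} {N : ℕ} {u : ℝ → ℝ} (hlam : 0 < lam)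
    (hlL : lam ≤ Lam) (h : IsDirichletSol lam Lam N q u) (hr0 : InflectionAt u r0) {ρ R r : ℝ}
    (hρ : ρ = u 0 ^ ((q - 1) / 2)) (hR : R ∈ Ioo 0 ρ)
    (hconv : 0 < pucciInv lam Lam (-((u 0)⁻¹ * u (R / ρ)) ^ q -
      lam * ((N : ℝ) - 1) * ((u 0)⁻¹ * ρ⁻¹ * deriv u (R / ρ) / R))) (hr : r ∈ Ico R ρ) :
    0 < pucciInv lam Lam (-((u 0)⁻¹ * u (r / ρ)) ^ q -
      lam * ((N : ℝ) - 1) * ((u 0)⁻¹ * ρ⁻¹ * deriv u (r / ρ) / r)) := by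
  obtain ⟨hC, hpos, h1, h0', hnonpos, heq⟩ := h
  obtain ⟨hr01, hcc, hzero, hcv⟩ := hr0
  have hM : 0 < u 0 := hpos 0 ⟨le_rfl, one_pos⟩
  have hρ0 : 0 < ρ := hρ ▸ Real.rpow_pos_of_pos hM _
  have hmul : 0 < (u 0)⁻¹ * ρ⁻¹ * ρ⁻¹ := by positivity
  have key : ∀ x ∈ Ioo 0 ρ, pucciInv lam Lam (-((u 0)⁻¹ * u (x / ρ)) ^ q -
      lam * ((N : ℝ) - 1) * ((u 0)⁻¹ * ρ⁻¹ * deriv u (x / ρ) / x)) =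
      (u 0)⁻¹ * ρ⁻¹ * ρ⁻¹ * deriv (deriv u) (x / ρ) := fun x hx => by
    have hx' : x / ρ ∈ Ioo (0 : ℝ) 1 := ⟨div_pos hx.1 hρ0, (div_lt_one hρ0).2 hx.2⟩
    rw [pucciInv_rescale hM hρ hx.1 (hpos _ ⟨hx'.1.le, hx'.2⟩).le,
      deriv_deriv_eq_pucciInv hlam hlL hx'.1 (hnonpos _ (Ioo_subset_Icc_self hx')) (heq _ hx')]
  rw [key R hR] at hconv
  have hpos' : 0 < deriv (deriv u) (R / ρ) := (mul_pos_iff_of_pos_left hmul).1 hconv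
  have hlt : r0 < R / ρ := by
    by_contra! hle
    rcases hle.eq_or_lt with h | h
    · rw [h, hzero] at hpos'
      exact lt_irrefl _ hpos'
    · exact lt_asymm hpos' (hcc _ ⟨(div_pos hR.1 hρ0).le, h⟩)
  rw [key r ⟨hR.1.trans_le hr.1, hr.2⟩]
  refine mul_pos hmul (hcv _ ⟨hlt.trans_le ?_, (div_lt_one hρ0).2 hr.2⟩)
  have := hr.1
  gcongr

/-- Asymptotic behavior of the rescaled solutions along sequences `rₙ → ∞` with
`rₙ ≤ ρₙ` and `ρₙ/rₙ → l ∈ [1,∞]`: one has `rₙ^{Ñ−2}·ũₙ(rₙ) → c₁(1 − l^{2−Ñ})`,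
where `l^{2−Ñ}` is interpreted as `0` when `l = +∞`. -/
theorem stmt_10 (lam Lam : ℝ) (N : ℕ) (Ntil pstar c1 R0 : ℝ)
    (hlam : 0 < lam) (hlL : lam ≤ Lam) (hN : 2 ≤ N)
    (hNtil : Ntil = lam / Lam * ((N : ℝ) - 1) + 1) (hNtil2 : 2 < Ntil)
    (hpstar : 1 < pstar)
    (U : ℝ → ℝ) (hU : IsEntireSol lam Lam N Ntil pstar c1 R0 U)
    (hnonex : ¬ ∃ w : ℝ → ℝ, IsDirichletSol lam Lam N pstar w)
    (ε : ℕ → ℝ) (hε : ∀ n, 0 < ε n) (hε0 : Tendsto ε atTop (nhds 0))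
    (hpn : ∀ n, 1 < pstar - ε n)
    (u : ℕ → ℝ → ℝ) (hu : ∀ n, IsDirichletSol lam Lam N (pstar - ε n) (u n))
    (r0 : ℕ → ℝ) (hr0 : ∀ n, InflectionAt (u n) (r0 n))
    (tilde : ℕ → ℝ → ℝ)
    (htilde : ∀ n, tilde n =
      fun r => (u n 0)⁻¹ * u n (r / (u n 0) ^ ((pstar - ε n - 1) / 2)))
    (rr : ℕ → ℝ) (hrr : Tendsto rr atTop atTop)
    (hrrle : ∀ n, rr n ≤ (u n 0) ^ ((pstar - ε n - 1) / 2))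
    (L : ℝ)
    (hL : (∃ l : ℝ, 1 ≤ l ∧
            Tendsto (fun n => (u n 0) ^ ((pstar - ε n - 1) / 2) / rr n) atTop (nhds l) ∧
            L = c1 * (1 - l ^ (2 - Ntil))) ∨
          (Tendsto (fun n => (u n 0) ^ ((pstar - ε n - 1) / 2) / rr n) atTop atTop ∧
            L = c1)) :
    Tendsto (fun n => rr n ^ (Ntil - 2) * tilde n (rr n)) atTop (nhds L) := by
  set ρ : ℕ → ℝ := fun n => u n 0 ^ ((pstar - ε n - 1) / 2) with hρdef
  have hρ : ∀ n, ρ n = u n 0 ^ ((pstar - ε n - 1) / 2) := fun n => rfl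
  have hM : ∀ n, 0 < u n 0 := fun n => (hu n).2.1 0 ⟨le_rfl, one_pos⟩
  have hρ0 : ∀ n, 0 < ρ n := fun n => Real.rpow_pos_of_pos (hM n) _
  have hk : (0 : ℝ) ≤ (N : ℝ) - 1 := by
    have : (2 : ℝ) ≤ N := by exact_mod_cast hN
    linarith
  have hm : 0 < Ntil - 2 := by linarith
  have hUrad := fun ρ : ℝ => hU.isRadialSol hlam hlL (ρ := ρ)
  obtain ⟨-, -, -, -, hUneg, hUeq, hR0, -, -, hUconv, hc1, hUlim, hVlim⟩ := hU
  have hVlim' : Tendsto (fun r : ℝ => r ^ (Ntil - 2 + 1) * deriv U r) atTop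
      (nhds (-(Ntil - 2) * c1)) := by
    rwa [show Ntil - 2 + 1 = Ntil - 1 by ring]
  have hplim : Tendsto (fun n => pstar - ε n) atTop (nhds pstar) := by
    simpa using hε0.const_sub pstar
  have hcore := tendsto_rpow_mul_sub_of_isRadialSol (p := fun n => pstar - ε n) (ρ := ρ)
    (w := fun n r => (u n 0)⁻¹ * u n (r / ρ n))
    (z := fun n r => (u n 0)⁻¹ * (ρ n)⁻¹ * deriv (u n) (r / ρ n)) hlam hlL hk hm
    (by rw [hNtil]; ring) hpstar hc1 hR0 (fun ρ _ => hUrad ρ)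
    (fun r hr => by
      have hr' := hR0.trans hr
      rw [← deriv_deriv_eq_pucciInv hlam hlL hr' (hUneg r hr').le (hUeq r hr')]
      exact hUconv r hr)
    hUlim hVlim' hpn (fun n => by linarith [hε n]) hplim
    (fun n => (hu n).isRadialSol hlam hlL (hr0 n) (hρ n))
    (fun n => continuousOn_const.mul ((hu n).1.continuousOn.comp (by fun_prop)
      (fun r hr => ⟨div_nonneg hr.1 (hρ0 n).le, (div_le_one (hρ0 n)).2 hr.2⟩)))
    (fun n => by simp [div_self (hρ0 n).ne', (hu n).2.2.1])
    (fun n R hR hconv r hr => (hu n).convex_of_le hlam hlL (hr0 n) (hρ n) hR hconv hr)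
    hrr hrrle
  have hlim : Tendsto (fun n => c1 * (1 - (ρ n / rr n) ^ (-(Ntil - 2)))) atTop (nhds L) := by
    rcases hL with ⟨l, hl1, hl, rfl⟩ | ⟨hl, rfl⟩
    · have := ((hl.rpow_const (p := 2 - Ntil) (Or.inl (by linarith))).const_sub 1).const_mul c1
      simpa only [neg_sub] using this
    · have := (((tendsto_rpow_neg_atTop hm).comp hl).const_sub 1).const_mul L
      simpa using this
  have hsum := hcore.add hlim
  rw [zero_add] at hsum
  refine hsum.congr (fun n => ?_)
  rw [htilde n]
  ring
end
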